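/- Let (Ω, F, P) be a probability space and Y = (Y_t)_{t≥0} a jointly measurable real-valued stochastic process such that there is an even function r : ℝ → ℝ with r(0) = 1 and, for every finite collection t₁, …, t_k ≥ 0 and reals c₁, …, c_k, the random variable Σᵢ cᵢ·Y_{tᵢ} is centered Gaussian with variance Σᵢ Σⱼ cᵢ·cⱼ·r(tᵢ − tⱼ). Assume there exist H ∈ (1/2, 1) and a finite constant C such that lim_{t→∞} r(t)/t^{2H−2} = C. Let α₊, α₋ > 0 with α₊ ≠ α₋, let X_t = α₊·Y_t·1_{Y_t>0} + α₋·Y_t·1_{Y_t<0}, let μ̂_i(T) = (1/T)·∫₀^T X_u^i du for i = 1, 2, and define α̂₊(T) = √(π/2)·μ̂₁(T) + (1/2)·√|4μ̂₂(T) − 2π·μ̂₁(T)²| and α̂₋(T) = −√(π/2)·μ̂₁(T) + (1/2)·√|4μ̂₂(T) − 2π·μ̂₁(T)²|. Then there exists a symmetric positive semidefinite 2×2 real matrix Σ_C such that the ℝ²-valued random vectors T^{1−H}·(α̂₊(T) − α₊, α̂₋(T) − α₋) converge in distribution, as T → ∞, to a centered bivariate Gaussian vector with covariance matrix Σ_C.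 -/

import Mathlib

open MeasureTheory ProbabilityTheory Real Filter Set

theorem integral_abs_gaussianReal : ∫ x, |x| ∂(gaussianReal 0 1) = √(2 / π) := by
  rw [integral_gaussianReal_eq_integral_smul one_ne_zero]
  have h1 : ∀ x : ℝ, gaussianPDFReal 0 1 x • |x|
      = (fun y : ℝ => (√(2 * π))⁻¹ * (y * rexp (-(1 / 2) * y ^ 2))) |x| := by
    intro x
    simp only [gaussianPDFReal, smul_eq_mul, sq_abs]
    simp
    ring_nf
  simp_rw [h1]
  rw [integral_comp_abs (f := fun y : ℝ => (√(2 * π))⁻¹ * (y * rexp (-(1 / 2) * y ^ 2))),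
    integral_const_mul]
  have h2 := integral_rpow_mul_exp_neg_mul_rpow (p := 2) (q := 1) (b := 1 / 2) (by norm_num)
    (by norm_num) (by norm_num)
  norm_num at h2
  have h3 : ∫ x in Ioi (0:ℝ), x * rexp (-(1 / 2) * x ^ 2) = 1 := by
    norm_num [neg_mul] at h2 ⊢
    exact h2
  rw [h3, mul_one, sqrt_div (by norm_num), sqrt_mul (by norm_num)]
  have := Real.sqrt_pos.2 pi_pos
  have h4 : √2 * √2 = 2 := Real.mul_self_sqrt (by norm_num)
  field_simp
  nlinarith

theorem measureReal_abs_le_gaussianReal {a : ℝ} (ha : 0 ≤ a) :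
    (gaussianReal 0 1).real {x | |x| ≤ a} ≤ a := by
  have hs : {x : ℝ | |x| ≤ a} = Icc (-a) a := by ext x; simp [abs_le]
  rw [hs, measureReal_def, gaussianReal_apply_eq_integral 0 one_ne_zero,
    ENNReal.toReal_ofReal (integral_nonneg fun x => gaussianPDFReal_nonneg _ _ _)]
  have h : ∀ x, gaussianPDFReal 0 1 x ≤ 1 / 2 := by
    intro x
    simp only [gaussianPDFReal, NNReal.coe_one, mul_one, sub_zero]
    have h1 : rexp (-x ^ 2 / 2) ≤ 1 := by
      rw [Real.exp_le_one_iff]; nlinarith [sq_nonneg x]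
    have h2 : (√(2 * π))⁻¹ ≤ 1 / 2 := by
      rw [one_div]
      apply inv_anti₀ (by norm_num)
      apply Real.le_sqrt_of_sq_le
      nlinarith [pi_gt_three]
    have h3 : 0 ≤ rexp (-x ^ 2 / 2) := (Real.exp_pos _).le
    nlinarith [inv_nonneg.2 (sqrt_nonneg (2 * π))]
  calc ∫ x in Icc (-a) a, gaussianPDFReal 0 1 x ≤ ∫ x in Icc (-a) a, (1 / 2 : ℝ) := by
        apply integral_mono (integrable_gaussianPDFReal 0 1).integrableOn
        · exact integrableOn_const (by simp)
        · exact fun x => h x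
    _ = a := by simp [ha]; ring

theorem integrable_pow_gaussianReal (n : ℕ) :
    Integrable (fun x : ℝ => x ^ n) (gaussianReal 0 1) := by
  rcases n.eq_zero_or_pos with rfl | hn
  · simp
  have h := (memLp_id_gaussianReal' (μ := 0) (v := 1) (n : ENNReal) (by simp)).integrable_norm_pow
    (by omega)
  rw [← integrable_norm_iff (by fun_prop)]
  simpa using h

theorem integral_sq_gaussianReal : ∫ x, x ^ 2 ∂(gaussianReal 0 1) = 1 := by
  have := variance_fun_id_gaussianReal (μ := 0) (v := 1)
  rw [variance_eq_integral (by fun_prop)] at this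
  simpa using this

theorem integral_comp_neg_gaussianReal (f : ℝ → ℝ) :
    ∫ x, f (-x) ∂(gaussianReal 0 1) = ∫ x, f x ∂(gaussianReal 0 1) := by
  have h : (gaussianReal 0 1).map (fun x : ℝ => -x) = gaussianReal 0 1 := by
    rw [gaussianReal_map_neg, neg_zero]
  conv_rhs => rw [← h]
  rw [(MeasurableEquiv.neg ℝ).measurableEmbedding.integral_map (f := fun x : ℝ => -x)]

theorem integral_odd_gaussianReal {f : ℝ → ℝ} (hf : ∀ x, f (-x) = -f x) :
    ∫ x, f x ∂(gaussianReal 0 1) = 0 := by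
  have h := integral_comp_neg_gaussianReal f
  simp_rw [hf, integral_neg] at h
  linarith

/-- A function of quadratic growth whose Mehler transform with correlation `ρ` is `O(ρ ^ 2)`,
i.e. whose Hermite rank is at least two. -/
structure HasHermiteRankTwo (g : ℝ → ℝ) : Prop where
  measurable : Measurable g
  bound : ∃ K, 0 ≤ K ∧ (∀ y, |g y| ≤ K * (1 + y ^ 2)) ∧ ∀ ρ : ℝ, |ρ| ≤ 1 / 2 → ∀ x,
    |∫ n, g (ρ * x + √(1 - ρ ^ 2) * n) ∂(gaussianReal 0 1)| ≤ K * ρ ^ 2 * (1 + x ^ 2)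

theorem integrable_comp_affine_gaussianReal {g : ℝ → ℝ} (hg : Measurable g) {K : ℝ}
    (hK : ∀ y, |g y| ≤ K * (1 + y ^ 2)) (a b : ℝ) :
    Integrable (fun n => g (a + b * n)) (gaussianReal 0 1) := by
  have h1 := integrable_pow_gaussianReal 1
  have h2 := integrable_pow_gaussianReal 2
  have hi : Integrable (fun n : ℝ => K * (1 + a ^ 2) + K * (2 * a * b) * n ^ 1
      + K * b ^ 2 * n ^ 2) (gaussianReal 0 1) :=
    ((integrable_const _).add (h1.const_mul _)).add (h2.const_mul _)
  refine hi.mono' (hg.comp (by fun_prop)).aestronglyMeasurable (ae_of_all _ fun n => ?_)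
  rw [Real.norm_eq_abs]
  refine (hK _).trans (le_of_eq ?_)
  ring

namespace HasHermiteRankTwo

theorem add {g h : ℝ → ℝ} (hg : HasHermiteRankTwo g) (hh : HasHermiteRankTwo h) :
    HasHermiteRankTwo (fun y => g y + h y) := by
  refine ⟨hg.measurable.add hh.measurable, ?_⟩
  obtain ⟨K, hK0, hK, hK'⟩ := hg.bound
  obtain ⟨L, hL0, hL, hL'⟩ := hh.bound
  refine ⟨K + L, by positivity, fun y => ?_, fun ρ hρ x => ?_⟩
  · have := abs_add_le (g y) (h y)
    linarith [hK y, hL y]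
  · rw [integral_add (integrable_comp_affine_gaussianReal hg.measurable hK _ _)
      (integrable_comp_affine_gaussianReal hh.measurable hL _ _)]
    refine (abs_add_le _ _).trans ?_
    linarith [hK' ρ hρ x, hL' ρ hρ x]

theorem const_mul {g : ℝ → ℝ} (hg : HasHermiteRankTwo g) (c : ℝ) :
    HasHermiteRankTwo (fun y => c * g y) := by
  refine ⟨hg.measurable.const_mul c, ?_⟩
  obtain ⟨K, hK0, hK, hK'⟩ := hg.bound
  refine ⟨|c| * K, by positivity, fun y => ?_, fun ρ hρ x => ?_⟩
  · rw [abs_mul, mul_assoc]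
    exact mul_le_mul_of_nonneg_left (hK y) (abs_nonneg c)
  · rw [integral_const_mul, abs_mul]
    refine (mul_le_mul_of_nonneg_left (hK' ρ hρ x) (abs_nonneg c)).trans (le_of_eq ?_)
    ring

end HasHermiteRankTwo

theorem one_sub_sqrt_one_sub_sq_le {ρ : ℝ} (hρ : |ρ| ≤ 1) : 1 - √(1 - ρ ^ 2) ≤ ρ ^ 2 := by
  have h : ρ ^ 2 ≤ 1 := by rw [← sq_abs]; nlinarith [abs_nonneg ρ]
  have h1 := Real.sq_sqrt (sub_nonneg.2 h)
  have h2 := Real.sqrt_nonneg (1 - ρ ^ 2)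
  nlinarith

theorem sqrt_one_sub_sq_le_one (ρ : ℝ) : √(1 - ρ ^ 2) ≤ 1 := by
  rw [Real.sqrt_le_one]
  nlinarith [sq_nonneg ρ]

theorem sqrt_two_div_pi_le_one : √(2 / π) ≤ 1 := by
  rw [Real.sqrt_le_one, div_le_one pi_pos]
  linarith [pi_gt_three]

theorem hasHermiteRankTwo_sq : HasHermiteRankTwo (fun y => y ^ 2 - 1) := by
  refine ⟨by fun_prop, 1, one_pos.le, fun y => ?_, fun ρ hρ x => ?_⟩
  · rw [abs_le]; constructor <;> nlinarith [sq_nonneg y]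
  have h1 := integrable_pow_gaussianReal 1
  have h2 := integrable_pow_gaussianReal 2
  have hs : √(1 - ρ ^ 2) ^ 2 = 1 - ρ ^ 2 := by
    apply Real.sq_sqrt
    rw [← sq_abs]; nlinarith [abs_nonneg ρ]
  have he : ∀ n : ℝ, (ρ * x + √(1 - ρ ^ 2) * n) ^ 2 - 1 = (ρ ^ 2 * x ^ 2 - 1)
      + (2 * ρ * x * √(1 - ρ ^ 2)) * n ^ 1 + (1 - ρ ^ 2) * n ^ 2 := by
    intro n; linear_combination n ^ 2 * hs
  simp_rw [he]
  have h3 : Integrable (fun n : ℝ => (ρ ^ 2 * x ^ 2 - 1) + (2 * ρ * x * √(1 - ρ ^ 2)) * n ^ 1)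
      (gaussianReal 0 1) := (integrable_const _).add (h1.const_mul _)
  rw [integral_add h3 (h2.const_mul _), integral_add (integrable_const _) (h1.const_mul _), integral_const_mul, integral_const_mul,
    integral_sq_gaussianReal]
  simp only [pow_one, integral_id_gaussianReal, integral_const, probReal_univ, smul_eq_mul]
  rw [abs_le]
  constructor <;> nlinarith [mul_nonneg (sq_nonneg ρ) (sq_nonneg x), sq_nonneg ρ]

theorem abs_add_mul_abs_sub_le (a b : ℝ) :
    |(a + b) * |a + b| - b * |b| - 2 * |b| * a| ≤ a ^ 2 := by
  rcases abs_cases (a + b) with ⟨h1, h1'⟩ | ⟨h1, h1'⟩ <;>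
  rcases abs_cases b with ⟨h2, h2'⟩ | ⟨h2, h2'⟩ <;> rw [h1, h2, abs_le] <;>
  constructor <;> nlinarith [sq_nonneg a, sq_nonneg b, sq_nonneg (a + b)]

theorem hasHermiteRankTwo_mul_abs :
    HasHermiteRankTwo (fun y => y * |y| - 2 * √(2 / π) * y) := by
  have hm0 : 0 ≤ √(2 / π) := Real.sqrt_nonneg _
  have hm1 := sqrt_two_div_pi_le_one
  have hbd : ∀ y : ℝ, |y * |y| - 2 * √(2 / π) * y| ≤ 4 * (1 + y ^ 2) := by
    intro y
    refine (abs_sub _ _).trans ?_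
    simp only [abs_mul, abs_abs, abs_of_nonneg hm0, abs_two]
    rw [← sq_abs y]
    nlinarith [abs_nonneg y, sq_nonneg (|y| - 1), mul_nonneg (sub_nonneg.2 hm1) (abs_nonneg y)]
  refine ⟨by fun_prop, 4, by norm_num, hbd, fun ρ hρ x => ?_⟩
  have hg : Measurable fun y : ℝ => y * |y| - 2 * √(2 / π) * y := by fun_prop
  have hi := integrable_comp_affine_gaussianReal hg hbd (ρ * x) (√(1 - ρ ^ 2))
  set s := √(1 - ρ ^ 2) with hs
  have hs0 : 0 ≤ s := Real.sqrt_nonneg _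
  have h1 := integrable_pow_gaussianReal 1
  simp only [pow_one] at h1
  have hi0 : Integrable (fun n : ℝ => 2 * √(2 / π) * s * n) (gaussianReal 0 1) := h1.const_mul _
  have habs : Integrable (fun n : ℝ => |n|) (gaussianReal 0 1) := h1.abs
  have hodd : ∫ n, (s * n * |s * n| - 2 * √(2 / π) * s * n) ∂(gaussianReal 0 1) = 0 := by
    apply integral_odd_gaussianReal
    intro n
    simp only [mul_neg, abs_neg]
    ring
  have hoddi : Integrable (fun n : ℝ => s * n * |s * n| - 2 * √(2 / π) * s * n)
      (gaussianReal 0 1) := by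
    have := integrable_comp_affine_gaussianReal hg hbd 0 s
    simpa [mul_assoc] using this
  have hlin : ∫ n, 2 * s * (ρ * x) * |n| - 2 * √(2 / π) * (ρ * x) ∂(gaussianReal 0 1)
      = -(1 - s) * (2 * √(2 / π) * (ρ * x)) := by
    rw [integral_sub (habs.const_mul _) (integrable_const _), integral_const_mul,
      integral_abs_gaussianReal]
    simp; ring
  have hlini : Integrable (fun n => 2 * s * (ρ * x) * |n| - 2 * √(2 / π) * (ρ * x))
      (gaussianReal 0 1) := (habs.const_mul _).sub (integrable_const _)
  have hle : |∫ n, ((ρ * x + s * n) * |ρ * x + s * n| - 2 * √(2 / π) * (ρ * x + s * n)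
      - (s * n * |s * n| - 2 * √(2 / π) * s * n)
      - (2 * s * (ρ * x) * |n| - 2 * √(2 / π) * (ρ * x))) ∂(gaussianReal 0 1)| ≤ (ρ * x) ^ 2 := by
    have := norm_integral_le_of_norm_le_const (μ := gaussianReal 0 1) (C := (ρ * x) ^ 2)
      (f := fun n => (ρ * x + s * n) * |ρ * x + s * n| - 2 * √(2 / π) * (ρ * x + s * n)
      - (s * n * |s * n| - 2 * √(2 / π) * s * n)
      - (2 * s * (ρ * x) * |n| - 2 * √(2 / π) * (ρ * x))) (ae_of_all _ fun n => ?_)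
    · simpa using this
    · refine le_trans (le_of_eq ?_) (abs_add_mul_abs_sub_le (ρ * x) (s * n))
      rw [Real.norm_eq_abs, abs_mul s n, abs_of_nonneg hs0]
      congr 1
      ring
  have hi2 : Integrable (fun n => (ρ * x + s * n) * |ρ * x + s * n| - 2 * √(2 / π) * (ρ * x + s * n)
      - (s * n * |s * n| - 2 * √(2 / π) * s * n)) (gaussianReal 0 1) := hi.sub hoddi
  rw [integral_sub hi2 hlini, integral_sub hi hoddi, hodd, hlin] at hle
  have h1s := one_sub_sqrt_one_sub_sq_le (ρ := ρ) (by linarith)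
  have h1s' := sqrt_one_sub_sq_le_one ρ
  rw [← hs] at h1s h1s'
  have hb : |(1 - s) * (2 * √(2 / π) * (ρ * x))| ≤ ρ ^ 2 * (1 + x ^ 2) := by
    rw [abs_mul, abs_of_nonneg (by linarith : 0 ≤ 1 - s)]
    apply mul_le_mul h1s _ (abs_nonneg _) (sq_nonneg _)
    rw [abs_mul, abs_mul ρ, abs_of_nonneg (by positivity)]
    have : |ρ| * |x| ≤ 1 / 2 * |x| := mul_le_mul_of_nonneg_right hρ (abs_nonneg x)
    rw [← sq_abs x]
    nlinarith [abs_nonneg x, sq_nonneg (|x| - 1), mul_nonneg (abs_nonneg ρ) (abs_nonneg x)]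
  rw [abs_le] at hle hb ⊢
  constructor <;> nlinarith [mul_nonneg (sq_nonneg ρ) (sq_nonneg x), sq_nonneg ρ]

theorem abs_add_sub_abs_sub_sign_le (a b : ℝ) :
    |(|a + b|) - |b| - SignType.sign b * a| ≤ {y : ℝ | |y| ≤ |a|}.indicator (fun _ => 2 * |a|) b := by
  by_cases hb : |b| ≤ |a|
  · rw [indicator_of_mem (by exact hb)]
    have h1 : |(|a + b|) - (|b|)| ≤ |a| := by
      have := abs_abs_sub_abs_le (a + b) b; simpa using this
    have h2 : |(SignType.sign b : ℝ) * a| ≤ |a| := by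
      rcases lt_trichotomy b 0 with h | h | h
      · simp [sign_neg h]
      · simp [h]
      · simp [sign_pos h]
    exact (abs_sub _ _).trans (by linarith)
  · rw [indicator_of_notMem (by exact hb)]
    push Not at hb
    rcases lt_trichotomy b 0 with h | h | h
    · rw [sign_neg h]
      rw [abs_of_neg h] at hb ⊢
      rw [abs_of_neg (by linarith [le_abs_self a] : a + b < 0)]
      simp
    · simp [h] at hb
      linarith [abs_nonneg a]
    · rw [sign_pos h]
      rw [abs_of_pos h] at hb ⊢
      rw [abs_of_pos (by linarith [neg_abs_le a] : 0 < a + b)]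
      simp

theorem hasHermiteRankTwo_abs : HasHermiteRankTwo (fun y => |y| - √(2 / π)) := by
  have hm0 : 0 ≤ √(2 / π) := Real.sqrt_nonneg _
  have hm1 := sqrt_two_div_pi_le_one
  have hbd : ∀ y : ℝ, |(|y|) - √(2 / π)| ≤ 6 * (1 + y ^ 2) := by
    intro y
    refine (abs_sub _ _).trans ?_
    simp only [abs_abs, abs_of_nonneg hm0]
    rw [← sq_abs y]
    nlinarith [abs_nonneg y, sq_nonneg (|y| - 1)]
  refine ⟨by fun_prop, 6, by norm_num, hbd, fun ρ hρ x => ?_⟩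
  have hg : Measurable fun y : ℝ => |y| - √(2 / π) := by fun_prop
  have hi := integrable_comp_affine_gaussianReal hg hbd (ρ * x) (√(1 - ρ ^ 2))
  have h1s := one_sub_sqrt_one_sub_sq_le (ρ := ρ) (by linarith)
  have h1s' := sqrt_one_sub_sq_le_one ρ
  set s := √(1 - ρ ^ 2) with hs
  have hρ2 : ρ ^ 2 ≤ 1 / 4 := by rw [← sq_abs]; nlinarith [abs_nonneg ρ]
  have hs0 : 1 / 2 ≤ s := by linarith
  have h1 := integrable_pow_gaussianReal 1
  simp only [pow_one] at h1
  have habs : Integrable (fun n : ℝ => |n|) (gaussianReal 0 1) := h1.abs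
  have hsig : Measurable fun n : ℝ => ((SignType.sign (s * n) : SignType) : ℝ) := by
    have : (fun n : ℝ => ((SignType.sign (s * n) : SignType) : ℝ))
        = fun n : ℝ => if 0 < s * n then (1 : ℝ) else if s * n < 0 then -1 else 0 := by
      ext n
      rcases lt_trichotomy (s * n) 0 with h | h | h
      · simp [sign_neg h, h, h.le]
      · simp [h]
      · simp [sign_pos h, h]
    rw [this]
    refine Measurable.ite (measurableSet_lt (by fun_prop) (by fun_prop)) (by fun_prop) ?_
    exact Measurable.ite (measurableSet_lt (by fun_prop) (by fun_prop)) (by fun_prop) (by fun_prop)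
  have hsi : Integrable (fun n : ℝ => ((SignType.sign (s * n) : SignType) : ℝ) * (ρ * x))
      (gaussianReal 0 1) := by
    apply Integrable.mul_const
    refine Integrable.of_bound hsig.aestronglyMeasurable 1 (ae_of_all _ fun n => ?_)
    rcases lt_trichotomy (s * n) 0 with h | h | h
    · simp [sign_neg h]
    · simp [h]
    · simp [sign_pos h]
  have hodd : ∫ n, ((SignType.sign (s * n) : SignType) : ℝ) * (ρ * x) ∂(gaussianReal 0 1) = 0 := by
    apply integral_odd_gaussianReal
    intro n
    rw [mul_neg, Left.sign_neg]
    simp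
  have hlini : Integrable (fun n => s * |n| - √(2 / π)) (gaussianReal 0 1) :=
    (habs.const_mul _).sub (integrable_const _)
  have hlin : ∫ n, s * |n| - √(2 / π) ∂(gaussianReal 0 1) = -((1 - s) * √(2 / π)) := by
    rw [integral_sub (habs.const_mul _) (integrable_const _), integral_const_mul,
      integral_abs_gaussianReal]
    simp; ring
  have hball : MeasurableSet {n : ℝ | |s * n| ≤ |ρ * x|} :=
    measurableSet_le (by fun_prop) (by fun_prop)
  have hle : |∫ n, (|ρ * x + s * n| - √(2 / π) - (s * |n| - √(2 / π))
      - ((SignType.sign (s * n) : SignType) : ℝ) * (ρ * x)) ∂(gaussianReal 0 1)|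
      ≤ ∫ n, {n : ℝ | |s * n| ≤ |ρ * x|}.indicator (fun _ => 2 * |ρ * x|) n
        ∂(gaussianReal 0 1) := by
    rw [← Real.norm_eq_abs]
    refine norm_integral_le_of_norm_le ((integrable_const _).indicator hball)
      (ae_of_all _ fun n => ?_)
    refine le_trans (le_of_eq ?_) (abs_add_sub_abs_sub_sign_le (ρ * x) (s * n))
    rw [Real.norm_eq_abs, abs_mul s n, abs_of_nonneg (by linarith : 0 ≤ s)]
    congr 1
    ring
  have hball2 : ∫ n, {n : ℝ | |s * n| ≤ |ρ * x|}.indicator (fun _ => 2 * |ρ * x|) n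
        ∂(gaussianReal 0 1) ≤ 4 * (ρ ^ 2 * x ^ 2) := by
    rw [integral_indicator_const _ hball, smul_eq_mul]
    have : (gaussianReal 0 1).real {n : ℝ | |s * n| ≤ |ρ * x|} ≤ 2 * |ρ * x| := by
      refine le_trans (measureReal_mono ?_) (measureReal_abs_le_gaussianReal (by positivity))
      intro n hn
      simp only [mem_ofPred_eq] at hn ⊢
      rw [abs_mul, abs_of_nonneg (by linarith : 0 ≤ s)] at hn
      nlinarith [abs_nonneg n]
    calc _ ≤ (2 * |ρ * x|) * (2 * |ρ * x|) := by gcongr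
      _ = 4 * |ρ * x| ^ 2 := by ring
      _ = _ := by rw [sq_abs]; ring
  have hi2 : Integrable (fun n => |ρ * x + s * n| - √(2 / π) - (s * |n| - √(2 / π)))
      (gaussianReal 0 1) := hi.sub hlini
  rw [integral_sub hi2 hsi, integral_sub hi hlini, hodd, hlin] at hle
  have hb : (1 - s) * √(2 / π) ≤ ρ ^ 2 * 1 :=
    mul_le_mul h1s hm1 hm0 (sq_nonneg _)
  have hb0 : 0 ≤ (1 - s) * √(2 / π) := mul_nonneg (by linarith) hm0
  have hle := hle.trans hball2
  rw [abs_le] at hle ⊢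
  constructor <;> nlinarith [mul_nonneg (sq_nonneg ρ) (sq_nonneg x), sq_nonneg ρ]

theorem HasHermiteRankTwo.exists_abs_integral_prod_le {g : ℝ → ℝ} (hg : HasHermiteRankTwo g) :
    ∃ K, 0 ≤ K ∧ ∀ ρ : ℝ, |ρ| ≤ 1 →
      Integrable (fun p : ℝ × ℝ => g p.1 * g (ρ * p.1 + √(1 - ρ ^ 2) * p.2))
        ((gaussianReal 0 1).prod (gaussianReal 0 1)) ∧
      |∫ p : ℝ × ℝ, g p.1 * g (ρ * p.1 + √(1 - ρ ^ 2) * p.2)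
        ∂((gaussianReal 0 1).prod (gaussianReal 0 1))| ≤ K * ρ ^ 2 := by
  obtain ⟨K, hK0, hK, hK'⟩ := hg.bound
  have hgm := hg.measurable
  have hx2 := integrable_pow_gaussianReal 2
  have hx4 := integrable_pow_gaussianReal 4
  have hi1 : Integrable (fun x : ℝ => K * (1 + x ^ 2)) (gaussianReal 0 1) :=
    ((integrable_const _).add hx2).const_mul _
  have hi2 : Integrable (fun x : ℝ => (1 + x ^ 2) ^ 2) (gaussianReal 0 1) := by
    have : Integrable (fun x : ℝ => 1 + 2 * x ^ 2 + x ^ 4) (gaussianReal 0 1) :=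
      ((integrable_const _).add (hx2.const_mul _)).add hx4
    refine this.congr (ae_of_all _ fun x => ?_)
    ring
  have hdom : Integrable (fun p : ℝ × ℝ => (1 + p.1 ^ 2) ^ 2 * (1 + p.2 ^ 2))
      ((gaussianReal 0 1).prod (gaussianReal 0 1)) :=
    hi2.mul_prod ((integrable_const 1).add hx2)
  set M := ∫ p : ℝ × ℝ, (1 + p.1 ^ 2) ^ 2 * (1 + p.2 ^ 2)
      ∂((gaussianReal 0 1).prod (gaussianReal 0 1)) with hM
  have hM0 : 0 ≤ M := integral_nonneg fun p => by positivity
  set J := ∫ x : ℝ, (1 + x ^ 2) ^ 2 ∂(gaussianReal 0 1) with hJ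
  have hJ0 : 0 ≤ J := integral_nonneg fun p => by positivity
  refine ⟨8 * K ^ 2 * M + K ^ 2 * J, by positivity, fun ρ hρ => ?_⟩
  have hρ2 : ρ ^ 2 ≤ 1 := by rw [← sq_abs]; nlinarith [abs_nonneg ρ]
  have hs := Real.sq_sqrt (sub_nonneg.2 hρ2)
  have hbd : ∀ p : ℝ × ℝ, ‖g p.1 * g (ρ * p.1 + √(1 - ρ ^ 2) * p.2)‖
      ≤ 2 * K ^ 2 * ((1 + p.1 ^ 2) ^ 2 * (1 + p.2 ^ 2)) := by
    rintro ⟨x, n⟩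
    simp only [Real.norm_eq_abs, abs_mul]
    have h1 := hK x
    have h2 := hK (ρ * x + √(1 - ρ ^ 2) * n)
    have h3 : (ρ * x + √(1 - ρ ^ 2) * n) ^ 2 ≤ x ^ 2 + n ^ 2 := by
      nlinarith [sq_nonneg (√(1 - ρ ^ 2) * x - ρ * n)]
    calc |g x| * |g (ρ * x + √(1 - ρ ^ 2) * n)|
        ≤ (K * (1 + x ^ 2)) * (K * (1 + (x ^ 2 + n ^ 2))) := by
          apply mul_le_mul h1 (h2.trans _) (abs_nonneg _) (by positivity)
          gcongr
      _ ≤ (K * (1 + x ^ 2)) * (K * (2 * ((1 + x ^ 2) * (1 + n ^ 2)))) := by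
          gcongr
          nlinarith [mul_nonneg (sq_nonneg x) (sq_nonneg n), sq_nonneg x, sq_nonneg n]
      _ = _ := by ring
  have hInt : Integrable (fun p : ℝ × ℝ => g p.1 * g (ρ * p.1 + √(1 - ρ ^ 2) * p.2))
      ((gaussianReal 0 1).prod (gaussianReal 0 1)) := by
    refine (hdom.const_mul (2 * K ^ 2)).mono' ?_ (ae_of_all _ hbd)
    exact ((hgm.comp measurable_fst).mul (hgm.comp (by fun_prop))).aestronglyMeasurable
  refine ⟨hInt, ?_⟩
  rcases le_or_gt |ρ| (1 / 2) with h | h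
  · rw [integral_prod _ hInt]
    have h1 : |∫ x, ∫ n, g x * g (ρ * x + √(1 - ρ ^ 2) * n) ∂(gaussianReal 0 1)
        ∂(gaussianReal 0 1)| ≤ ∫ x : ℝ, K ^ 2 * ρ ^ 2 * (1 + x ^ 2) ^ 2 ∂(gaussianReal 0 1) := by
      rw [← Real.norm_eq_abs]
      refine norm_integral_le_of_norm_le (hi2.const_mul _) (ae_of_all _ fun x => ?_)
      rw [integral_const_mul, Real.norm_eq_abs, abs_mul]
      calc _ ≤ (K * (1 + x ^ 2)) * (K * ρ ^ 2 * (1 + x ^ 2)) :=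
            mul_le_mul (hK x) (hK' ρ h x) (abs_nonneg _) (by positivity)
        _ = _ := by ring
    rw [integral_const_mul, ← hJ] at h1
    refine h1.trans ?_
    nlinarith [mul_nonneg (mul_nonneg (sq_nonneg K) hM0) (sq_nonneg ρ)]
  · have h1 := norm_integral_le_of_norm_le (hdom.const_mul (2 * K ^ 2)) (ae_of_all _ hbd)
    rw [integral_const_mul, ← hM, Real.norm_eq_abs] at h1
    refine h1.trans ?_
    have h4 : 1 ≤ 4 * ρ ^ 2 := by rw [← sq_abs]; nlinarith
    nlinarith [mul_nonneg (mul_nonneg (sq_nonneg K) hJ0) (sq_nonneg ρ),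
      mul_nonneg (mul_nonneg (sq_nonneg K) hM0) (sub_nonneg.2 h4)]

section GaussianPair

variable {Ω : Type*} [MeasurableSpace Ω] {P : Measure Ω}

theorem integrable_sq_of_map_eq_gaussianReal {U : Ω → ℝ} (hU : Measurable U) {v : NNReal}
    (h : P.map U = gaussianReal 0 v) : MemLp U 2 P ∧ ∫ ω, U ω ^ 2 ∂P = v := by
  have h1 : MemLp id 2 (P.map U) := by rw [h]; exact memLp_id_gaussianReal' 2 (by simp)
  rw [memLp_map_measure_iff (by fun_prop) hU.aemeasurable] at h1
  refine ⟨h1, ?_⟩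
  have := variance_fun_id_gaussianReal (μ := 0) (v := v)
  rw [variance_eq_integral (by fun_prop), ← h, integral_map hU.aemeasurable (by fun_prop),
    h] at this
  simpa using this

/-- If all linear combinations of `U`, `V` are Gaussian with the variance dictated by unit
variances and correlation `ρ`, then `ρ` really is the covariance of `U` and `V`. -/
theorem integral_mul_eq_of_gaussian_pair {U V : Ω → ℝ} (hU : Measurable U) (hV : Measurable V)
    {ρ : ℝ} (h : ∀ c d : ℝ, P.map (fun ω => c * U ω + d * V ω)
      = gaussianReal 0 (Real.toNNReal (c ^ 2 + 2 * c * d * ρ + d ^ 2))) :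
    ∫ ω, U ω * V ω ∂P = ρ ∧ |ρ| ≤ 1 := by
  have hUU := integrable_sq_of_map_eq_gaussianReal (by fun_prop) (h 1 0)
  have hVV := integrable_sq_of_map_eq_gaussianReal (by fun_prop) (h 0 1)
  simp only [one_mul, zero_mul, add_zero, zero_add] at hUU hVV
  norm_num at hUU hVV
  have hmul : Integrable (fun ω => U ω * V ω) P := hUU.1.integrable_mul hVV.1
  have key : ∀ c d : ℝ, ∫ ω, (c * U ω + d * V ω) ^ 2 ∂P
      = c ^ 2 + 2 * c * d * (∫ ω, U ω * V ω ∂P) + d ^ 2 := by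
    intro c d
    have e : ∀ ω, (c * U ω + d * V ω) ^ 2
        = c ^ 2 * U ω ^ 2 + 2 * c * d * (U ω * V ω) + d ^ 2 * V ω ^ 2 := fun ω => by ring
    have i1 : Integrable (fun ω => c ^ 2 * U ω ^ 2) P := hUU.1.integrable_sq.const_mul _
    have i2 : Integrable (fun ω => 2 * c * d * (U ω * V ω)) P := hmul.const_mul _
    have i3 : Integrable (fun ω => d ^ 2 * V ω ^ 2) P := hVV.1.integrable_sq.const_mul _
    have i4 : Integrable (fun ω => c ^ 2 * U ω ^ 2 + 2 * c * d * (U ω * V ω)) P := i1.add i2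
    simp_rw [e]
    rw [integral_add i4 i3, integral_add i1 i2, integral_const_mul, integral_const_mul,
      integral_const_mul, hUU.2, hVV.2]
    ring
  have k1 := key 1 1
  have k2 := key 1 (-1)
  rw [(integrable_sq_of_map_eq_gaussianReal (by fun_prop) (h _ _)).2] at k1 k2
  simp only [Real.coe_toNNReal'] at k1 k2
  norm_num at k1 k2
  set q := ∫ ω, U ω * V ω ∂P
  have : q = ρ := by
    rcases max_cases (1 + 2 * ρ + 1) 0 with h1 | h1 <;>
      rcases max_cases (1 + -(2 * ρ) + 1) 0 with h2 | h2 <;> linarith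
  refine ⟨this, ?_⟩
  rw [abs_le]
  have m1 := le_max_right (1 + 2 * ρ + 1) 0
  have m2 := le_max_right (1 + -(2 * ρ) + 1) 0
  constructor <;> linarith

theorem map_prodMk_eq_of_gaussian_pair [IsProbabilityMeasure P] {U V : Ω → ℝ} (hU : Measurable U) (hV : Measurable V)
    {ρ : ℝ} (h : ∀ c d : ℝ, P.map (fun ω => c * U ω + d * V ω)
      = gaussianReal 0 (Real.toNNReal (c ^ 2 + 2 * c * d * ρ + d ^ 2))) :
    P.map (fun ω => (U ω, V ω)) = ((gaussianReal 0 1).prod (gaussianReal 0 1)).map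
      (fun p : ℝ × ℝ => (p.1, ρ * p.1 + √(1 - ρ ^ 2) * p.2)) := by
  have hρ := (integral_mul_eq_of_gaussian_pair hU hV h).2
  have hρ2 : 0 ≤ 1 - ρ ^ 2 := by rw [← sq_abs]; nlinarith [abs_nonneg ρ]
  have : IsProbabilityMeasure (P.map (fun ω => (U ω, V ω))) :=
    Measure.isProbabilityMeasure_map (by fun_prop)
  have : IsProbabilityMeasure (((gaussianReal 0 1).prod (gaussianReal 0 1)).map
      (fun p : ℝ × ℝ => (p.1, ρ * p.1 + √(1 - ρ ^ 2) * p.2))) :=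
    Measure.isProbabilityMeasure_map (by fun_prop)
  refine Measure.ext_of_charFunDual (funext fun L => ?_)
  have hL : ∀ x y : ℝ, L (x, y) = L (1, 0) * x + L (0, 1) * y := by
    intro x y
    have : ((x, y) : ℝ × ℝ) = x • (1, 0) + y • (0, 1) := by simp
    rw [this, map_add, map_smul, map_smul, smul_eq_mul, smul_eq_mul]
    ring
  set c := L (1, 0)
  set d := L (0, 1)
  have hrhs : ((gaussianReal 0 1).prod (gaussianReal 0 1)).map
      (fun p : ℝ × ℝ => (c + d * ρ) * p.1 + d * √(1 - ρ ^ 2) * p.2)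
      = gaussianReal 0 (Real.toNNReal (c ^ 2 + 2 * c * d * ρ + d ^ 2)) := by
    have hind : IndepFun (fun p : ℝ × ℝ => (c + d * ρ) * p.1)
        (fun p : ℝ × ℝ => d * √(1 - ρ ^ 2) * p.2)
        ((gaussianReal 0 1).prod (gaussianReal 0 1)) :=
      indepFun_prod (X := fun x : ℝ => (c + d * ρ) * x)
        (Y := fun x : ℝ => d * √(1 - ρ ^ 2) * x) (by fun_prop) (by fun_prop)
    have e1 : ((gaussianReal 0 1).prod (gaussianReal 0 1)).map
        (fun p : ℝ × ℝ => (c + d * ρ) * p.1)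
        = gaussianReal ((c + d * ρ) * 0) (NNReal.mk ((c + d * ρ) ^ 2) (sq_nonneg _) * 1) := by
      calc _ = (((gaussianReal 0 1).prod (gaussianReal 0 1)).map Prod.fst).map
            (fun x => (c + d * ρ) * x) := (Measure.map_map (by fun_prop) measurable_fst).symm
        _ = (gaussianReal 0 1).map (fun x => (c + d * ρ) * x) := by
            rw [← Measure.fst, Measure.fst_prod]
        _ = _ := gaussianReal_map_const_mul _
    have e2 : ((gaussianReal 0 1).prod (gaussianReal 0 1)).map
        (fun p : ℝ × ℝ => d * √(1 - ρ ^ 2) * p.2)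
        = gaussianReal (d * √(1 - ρ ^ 2) * 0) (NNReal.mk ((d * √(1 - ρ ^ 2)) ^ 2) (sq_nonneg _) * 1) := by
      calc _ = (((gaussianReal 0 1).prod (gaussianReal 0 1)).map Prod.snd).map
            (fun x => (d * √(1 - ρ ^ 2)) * x) := (Measure.map_map (by fun_prop) measurable_snd).symm
        _ = (gaussianReal 0 1).map (fun x => (d * √(1 - ρ ^ 2)) * x) := by
            rw [← Measure.snd, Measure.snd_prod]
        _ = _ := gaussianReal_map_const_mul _
    have := gaussianReal_add_gaussianReal_of_indepFun hind e1 e2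
    have e3 : (fun p : ℝ × ℝ => (c + d * ρ) * p.1 + d * √(1 - ρ ^ 2) * p.2)
        = (fun p : ℝ × ℝ => (c + d * ρ) * p.1) + (fun p : ℝ × ℝ => d * √(1 - ρ ^ 2) * p.2) := rfl
    rw [e3, this]
    congr 1
    · ring
    · have e4 : (c + d * ρ) ^ 2 + (d * √(1 - ρ ^ 2)) ^ 2 = c ^ 2 + 2 * c * d * ρ + d ^ 2 := by
        rw [mul_pow, Real.sq_sqrt hρ2]; ring
      apply NNReal.coe_injective
      rw [← e4, Real.coe_toNNReal _ (by positivity)]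
      simp
  rw [charFunDual_eq_charFun_map_one, charFunDual_eq_charFun_map_one,
    Measure.map_map (by fun_prop) (by fun_prop), Measure.map_map (by fun_prop) (by fun_prop)]
  congr 1
  have e5 : (⇑L ∘ fun ω => (U ω, V ω)) = fun ω => c * U ω + d * V ω := by
    ext ω; simp [hL]
  have e6 : (⇑L ∘ fun p : ℝ × ℝ => (p.1, ρ * p.1 + √(1 - ρ ^ 2) * p.2))
      = fun p : ℝ × ℝ => (c + d * ρ) * p.1 + d * √(1 - ρ ^ 2) * p.2 := by
    ext p; simp only [Function.comp, hL]; ring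
  rw [e5, e6, h, hrhs]

end GaussianPair

section SecondMoment

variable {Ω : Type*} [MeasurableSpace Ω] {P : Measure Ω} [IsProbabilityMeasure P]

/-- A jointly measurable random field with uniformly bounded second moments is square integrable
on the product space. -/
lemma memLp_two_uncurry {ι : Type*} [MeasurableSpace ι] {ν : Measure ι} [IsFiniteMeasure ν]
    {G : ι → Ω → ℝ} (hG : Measurable (Function.uncurry G)) {K : ℝ}
    (h : ∀ᵐ u ∂ν, MemLp (G u) 2 P ∧ ∫ ω, G u ω ^ 2 ∂P ≤ K) :
    MemLp (Function.uncurry G) 2 (ν.prod P) := by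
  rw [memLp_two_iff_integrable_sq hG.aestronglyMeasurable,
    integrable_prod_iff (by exact (hG.pow_const 2).aestronglyMeasurable)]
  refine ⟨?_, ?_⟩
  · filter_upwards [h] with u hu
    exact hu.1.integrable_sq
  · refine Integrable.of_bound (C := K) ?_ ?_
    · exact (((hG.pow_const 2).norm).stronglyMeasurable.integral_prod_right).aestronglyMeasurable
    · filter_upwards [h] with u hu
      have : (fun ω => ‖Function.uncurry G (u, ω) ^ 2‖) = fun ω => G u ω ^ 2 := by
        ext ω; simp [Function.uncurry]
      rw [this, Real.norm_of_nonneg (integral_nonneg fun ω => sq_nonneg _)]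
      exact hu.2

/-- The second moment of the time integral of a random field is the double integral of its
correlation function. -/
lemma integral_sq_integral_eq {ν : Measure ℝ} [IsFiniteMeasure ν]
    {G : ℝ → Ω → ℝ} (hG : Measurable (Function.uncurry G)) {K : ℝ}
    (h : ∀ᵐ u ∂ν, MemLp (G u) 2 P ∧ ∫ ω, G u ω ^ 2 ∂P ≤ K) :
    Integrable (fun ω => (∫ u, G u ω ∂ν) ^ 2) P ∧
    AEStronglyMeasurable (fun q : ℝ × ℝ => ∫ ω, G q.1 ω * G q.2 ω ∂P) (ν.prod ν) ∧
    ∫ ω, (∫ u, G u ω ∂ν) ^ 2 ∂P = ∫ q, (∫ ω, G q.1 ω * G q.2 ω ∂P) ∂(ν.prod ν) := by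
  have h1 : MemLp (Function.uncurry fun (q : ℝ × ℝ) ω => G q.1 ω) 2 ((ν.prod ν).prod P) :=
    memLp_two_uncurry (by exact hG.comp (by fun_prop : Measurable
      fun z : (ℝ × ℝ) × Ω => (z.1.1, z.2))) (Measure.quasiMeasurePreserving_fst.ae h)
  have h2 : MemLp (Function.uncurry fun (q : ℝ × ℝ) ω => G q.2 ω) 2 ((ν.prod ν).prod P) :=
    memLp_two_uncurry (by exact hG.comp (by fun_prop : Measurable
      fun z : (ℝ × ℝ) × Ω => (z.1.2, z.2))) (Measure.quasiMeasurePreserving_snd.ae h)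
  have h3 : Integrable (Function.uncurry fun (q : ℝ × ℝ) ω => G q.1 ω * G q.2 ω)
      ((ν.prod ν).prod P) := h1.integrable_mul h2
  have e : ∀ ω, (∫ u, G u ω ∂ν) ^ 2 = ∫ q, G q.1 ω * G q.2 ω ∂(ν.prod ν) := by
    intro ω
    rw [sq]
    exact (integral_prod_mul (fun u => G u ω) (fun u => G u ω)).symm
  simp_rw [e]
  exact ⟨h3.integral_prod_right, h3.integral_prod_left.aestronglyMeasurable,
    (integral_integral_swap h3).symm⟩

end SecondMoment

lemma norm_sq_Lp_two {Ω : Type*} [MeasurableSpace Ω] {P : Measure Ω} (f : Lp ℝ 2 P) : ‖f‖ ^ 2 = ∫ ω, f ω ^ 2 ∂P := by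
  rw [← real_inner_self_eq_norm_sq, L2.inner_def]
  simp [sq]

section GaussianIntegral

variable {Ω : Type*} [MeasurableSpace Ω] {P : Measure Ω} [IsProbabilityMeasure P]

lemma continuous_charFun_Lp (t : ℝ) :
    Continuous fun f : Lp ℝ 2 P => ∫ ω, Complex.exp (t * f ω * Complex.I) ∂P := by
  have hInt : ∀ f : Lp ℝ 2 P, Integrable (fun ω => Complex.exp (t * f ω * Complex.I)) P := by
    intro f
    have hf := Lp.aestronglyMeasurable f
    refine Integrable.of_bound (C := 1) (by fun_prop) (ae_of_all _ fun ω => ?_)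
    rw [← Complex.ofReal_mul, Complex.norm_exp_ofReal_mul_I]
  refine (LipschitzWith.of_dist_le_mul (K := ‖t‖₊) fun f g => ?_).continuous
  rw [dist_eq_norm, ← integral_sub (hInt f) (hInt g)]
  have h1 : ∀ ω, ‖Complex.exp (t * f ω * Complex.I) - Complex.exp (t * g ω * Complex.I)‖
      ≤ |t| * ‖f ω - g ω‖ := by
    intro ω
    have e : Complex.exp (t * f ω * Complex.I) - Complex.exp (t * g ω * Complex.I)
        = Complex.exp (↑(t * g ω) * Complex.I)
          * (Complex.exp (Complex.I * ↑(t * (f ω - g ω))) - 1) := by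
      rw [mul_sub, ← Complex.exp_add]
      push_cast
      ring_nf
    rw [e, norm_mul, Complex.norm_exp_ofReal_mul_I, one_mul]
    refine (Real.norm_exp_I_mul_ofReal_sub_one_le).trans ?_
    rw [norm_mul, Real.norm_eq_abs t]
  have hfg : Integrable (fun ω => f ω - g ω) P :=
    ((Lp.memLp f).sub (Lp.memLp g)).integrable one_le_two
  calc _ ≤ ∫ ω, |t| * ‖f ω - g ω‖ ∂P :=
        norm_integral_le_of_norm_le (hfg.norm.const_mul _) (ae_of_all _ h1)
    _ = |t| * (eLpNorm (fun ω => f ω - g ω) 1 P).toReal := by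
        rw [integral_const_mul, integral_norm_eq_lintegral_enorm hfg.1,
          eLpNorm_one_eq_lintegral_enorm]
    _ ≤ |t| * (eLpNorm (fun ω => f ω - g ω) 2 P).toReal := by
        gcongr
        · exact ((Lp.memLp f).sub (Lp.memLp g)).2.ne
        · exact eLpNorm_le_eLpNorm_of_exponent_le one_le_two hfg.1
    _ = _ := by
        rw [Lp.dist_def]
        rfl

/-- Characteristic functions of centered Gaussian variables are preserved under `L²` closure. -/
lemma charFun_gaussian_of_mem_closure {S : Set (Lp ℝ 2 P)} {t : ℝ}
    (hS : ∀ f ∈ S, ∫ ω, Complex.exp (t * f ω * Complex.I) ∂P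
      = Complex.exp (-((‖f‖ : ℝ) ^ 2 * t ^ 2 / 2 : ℝ)))
    {f : Lp ℝ 2 P} (hf : f ∈ closure S) :
    ∫ ω, Complex.exp (t * f ω * Complex.I) ∂P
      = Complex.exp (-((‖f‖ : ℝ) ^ 2 * t ^ 2 / 2 : ℝ)) := by
  have hc : IsClosed {f : Lp ℝ 2 P | ∫ ω, Complex.exp (t * f ω * Complex.I) ∂P
      = Complex.exp (-((‖f‖ : ℝ) ^ 2 * t ^ 2 / 2 : ℝ))} :=
    isClosed_eq (continuous_charFun_Lp t) (by fun_prop)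
  exact closure_minimal hS hc hf

/-- The time integral of a Gaussian process is Gaussian. -/
lemma map_integral_eq_gaussianReal {ν : Measure ℝ} [IsFiniteMeasure ν] {Y : ℝ → Ω → ℝ}
    (hY : Measurable (Function.uncurry Y)) (hν : ∀ᵐ u ∂ν, 0 ≤ u)
    (hGauss : ∀ (k : ℕ) (t c : Fin k → ℝ), (∀ i, 0 ≤ t i) →
      ∃ v, P.map (fun ω => ∑ i, c i * Y (t i) ω) = gaussianReal 0 v)
    (hL2 : MemLp (Function.uncurry Y) 2 (ν.prod P))
    (hW2 : MemLp (fun ω => ∫ u, Y u ω ∂ν) 2 P) :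
    P.map (fun ω => ∫ u, Y u ω ∂ν)
      = gaussianReal 0 (Real.toNNReal (∫ ω, (∫ u, Y u ω ∂ν) ^ 2 ∂P)) := by
  set W : Ω → ℝ := fun ω => ∫ u, Y u ω ∂ν
  have hYm : ∀ u, Measurable (Y u) := fun u => hY.of_uncurry_left
  have hmem : ∀ u, 0 ≤ u → MemLp (Y u) 2 P := by
    intro u hu
    obtain ⟨v, hv⟩ := hGauss 1 (fun _ => u) (fun _ => 1) (fun _ => hu)
    simp only [Finset.univ_unique, one_mul, Finset.sum_const, Finset.card_singleton, one_smul]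
      at hv
    exact (integrable_sq_of_map_eq_gaussianReal (hYm u) hv).1
  let e : {u : ℝ // 0 ≤ u} → Lp ℝ 2 P := fun u => (hmem u.1 u.2).toLp (Y u.1)
  let S : Submodule ℝ (Lp ℝ 2 P) := Submodule.span ℝ (Set.range e)
  have hSchar : ∀ t : ℝ, ∀ f ∈ (S : Set (Lp ℝ 2 P)),
      ∫ ω, Complex.exp (t * f ω * Complex.I) ∂P
        = Complex.exp (-((‖f‖ : ℝ) ^ 2 * t ^ 2 / 2 : ℝ)) := by
    intro t f hf
    obtain ⟨n, c, g, rfl⟩ := Submodule.mem_span_set'.1 (SetLike.mem_coe.1 hf)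
    choose u hu using fun i => (g i).2
    set f := ∑ i, c i • (g i : Lp ℝ 2 P) with hfdef
    have hae : f =ᵐ[P] fun ω => ∑ i, c i * Y (u i).1 ω := by
      have h1 : ∀ i, ∀ᵐ ω ∂P, (c i • (g i : Lp ℝ 2 P)) ω = c i * Y (u i).1 ω := by
        intro i
        filter_upwards [Lp.coeFn_smul (c i) (g i : Lp ℝ 2 P),
          (hmem (u i).1 (u i).2).coeFn_toLp] with ω h1 h2
        rw [h1, Pi.smul_apply, smul_eq_mul, ← hu i, h2]
      filter_upwards [Lp.coeFn_fun_finsetSum Finset.univ (fun i => c i • (g i : Lp ℝ 2 P)),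
        ae_all_iff.2 h1] with ω h2 h3
      rw [hfdef, h2]
      exact Finset.sum_congr rfl fun i _ => h3 i
    obtain ⟨v, hv⟩ := hGauss n (fun i => (u i).1) c (fun i => (u i).2)
    have hm : Measurable (fun ω => ∑ i, c i * Y (u i).1 ω) :=
      Finset.measurable_sum _ fun i _ => (hYm _).const_mul _
    have hnorm : ‖f‖ ^ 2 = v := by
      rw [norm_sq_Lp_two, ← (integrable_sq_of_map_eq_gaussianReal hm hv).2]
      refine integral_congr_ae ?_
      filter_upwards [hae] with ω h
      rw [h]
    have hc := charFun_gaussianReal (μ := 0) (v := v) t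
    rw [← hv, charFun_apply_real, integral_map hm.aemeasurable (by fun_prop)] at hc
    rw [hnorm]
    refine (integral_congr_ae ?_).trans (hc.trans ?_)
    · filter_upwards [hae] with ω h
      rw [h]
    · congr 1
      push_cast
      ring
  have hW0 : hW2.toLp W ∈ closure (S : Set (Lp ℝ 2 P)) := by
    rw [← Submodule.topologicalClosure_coe, ← Submodule.orthogonal_orthogonal_eq_closure,
      SetLike.mem_coe, Submodule.mem_orthogonal]
    intro Z hZ
    have hZu : ∀ u, 0 ≤ u → ∫ ω, Z ω * Y u ω ∂P = 0 := by
      intro u hu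
      have h1 := (Submodule.mem_orthogonal _ _).1 hZ (e ⟨u, hu⟩)
        (Submodule.subset_span (Set.mem_range_self _))
      rw [L2.inner_def] at h1
      rw [← h1]
      refine integral_congr_ae ?_
      filter_upwards [(hmem u hu).coeFn_toLp] with ω h2
      simp only [e, h2]
      simp
    have hZ2 : MemLp (fun p : ℝ × Ω => Z p.2) 2 (ν.prod P) := (Lp.memLp Z).comp_snd ν
    have hInt : Integrable (Function.uncurry fun u ω => Z ω * Y u ω) (ν.prod P) :=
      hZ2.integrable_mul hL2
    rw [L2.inner_def]
    calc _ = ∫ ω, ∫ u, Z ω * Y u ω ∂ν ∂P := by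
          refine integral_congr_ae ?_
          filter_upwards [hW2.coeFn_toLp] with ω h2
          rw [h2, integral_const_mul]
          simp [W, mul_comm]
      _ = ∫ u, ∫ ω, Z ω * Y u ω ∂P ∂ν := (integral_integral_swap hInt).symm
      _ = 0 := by
          refine integral_eq_zero_of_ae ?_
          filter_upwards [hν] with u hu
          exact hZu u hu
  have hWn : ‖hW2.toLp W‖ ^ 2 = ∫ ω, W ω ^ 2 ∂P := by
    rw [norm_sq_Lp_two]
    refine integral_congr_ae ?_
    filter_upwards [hW2.coeFn_toLp] with ω h
    rw [h]
  have hWm : AEMeasurable W P := hW2.1.aemeasurable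
  have : IsProbabilityMeasure (P.map W) := Measure.isProbabilityMeasure_map hWm
  refine Measure.ext_of_charFun (funext fun t => ?_)
  rw [charFun_gaussianReal, charFun_apply_real, integral_map hWm (by fun_prop),
    Real.coe_toNNReal _ (integral_nonneg fun ω => sq_nonneg _)]
  have := charFun_gaussian_of_mem_closure (hSchar t) hW0
  rw [hWn] at this
  refine (integral_congr_ae ?_).trans (this.trans ?_)
  · filter_upwards [hW2.coeFn_toLp] with ω h
    rw [h]
  · congr 1
    push_cast
    ring

end GaussianIntegral

section LongRangeKernel

lemma integrable_abs_sub_rpow {β : ℝ} (hβ : -1 < β) :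
    Integrable (fun q : ℝ × ℝ => |q.1 - q.2| ^ β)
      ((volume.restrict (Set.Ioc (0 : ℝ) 1)).prod (volume.restrict (Set.Ioc (0 : ℝ) 1))) := by
  have h1 : IntervalIntegrable (fun x : ℝ => |x| ^ β) volume (-1) 1 := by
    refine intervalIntegrable_of_even (fun x => by rw [abs_neg]) (fun x hx => ?_)
    refine (intervalIntegral.intervalIntegrable_rpow' (a := 0) (b := x) hβ).congr ?_
    intro y hy
    rw [Set.uIoc_of_le hx.le] at hy
    simp only [abs_of_pos hy.1]
  have hg : Integrable ((Set.Ioc (-1 : ℝ) 1).indicator fun x : ℝ => |x| ^ β) volume := by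
    rw [integrable_indicator_iff measurableSet_Ioc]
    exact (intervalIntegrable_iff_integrableOn_Ioc_of_le (by norm_num)).1 h1
  have hf : Integrable (fun _ : ℝ => (1 : ℝ)) (volume.restrict (Set.Ioc (0 : ℝ) 1)) :=
    integrable_const _
  have h2 := (hf.convolution_integrand (ContinuousLinearMap.mul ℝ ℝ) hg).mono_measure
    (Measure.prod_mono (Measure.restrict_le_self (μ := volume) (s := Set.Ioc (0 : ℝ) 1))
      (le_refl (volume.restrict (Set.Ioc (0 : ℝ) 1))))
  refine h2.congr ?_
  rw [Measure.prod_restrict]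
  filter_upwards [ae_restrict_mem (measurableSet_Ioc.prod measurableSet_Ioc)] with q hq
  have hq1 := hq.1
  have hq2 := hq.2
  have : q.1 - q.2 ∈ Set.Ioc (-1 : ℝ) 1 :=
    ⟨by linarith [hq1.1, hq2.2], by linarith [hq1.2, hq2.1]⟩
  simp [Set.indicator_of_mem this]

lemma ae_fst_ne_snd :
    ∀ᵐ q ∂((volume.restrict (Set.Ioc (0 : ℝ) 1)).prod (volume.restrict (Set.Ioc (0 : ℝ) 1))),
      q.1 ≠ q.2 := by
  refine (Measure.ae_prod_iff_ae_ae (p := fun q : ℝ × ℝ => q.1 ≠ q.2)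
    (measurableSet_eq_fun measurable_fst measurable_snd).compl).2 (ae_of_all _ fun x => ?_)
  filter_upwards [Measure.ae_ne (volume.restrict (Set.Ioc (0 : ℝ) 1)) x] with y hy
  exact hy.symm

variable {r : ℝ → ℝ} {β C : ℝ}

lemma tendsto_rpow_mul_comp_mul (hreven : ∀ t, r (-t) = r t)
    (hlim : Tendsto (fun t : ℝ => r t / t ^ β) atTop (nhds C)) {z : ℝ} (hz : z ≠ 0) :
    Tendsto (fun T : ℝ => T ^ (-β) * r (T * z)) atTop (nhds (C * |z| ^ β)) := by
  have hz' : 0 < |z| := abs_pos.2 hz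
  have h1 := (hlim.comp (tendsto_id.atTop_mul_const hz')).mul_const (|z| ^ β)
  refine h1.congr' ?_
  filter_upwards [eventually_gt_atTop 0] with T hT
  have h2 : r (T * |z|) = r (T * z) := by
    rcases abs_choice z with h | h
    · rw [h]
    · rw [h, mul_neg, hreven]
  simp only [Function.comp, id]
  rw [h2, Real.mul_rpow hT.le hz'.le, Real.rpow_neg hT.le]
  have := (Real.rpow_pos_of_pos hT β).ne'
  have := (Real.rpow_pos_of_pos hz' β).ne'
  field_simp

lemma exists_abs_le_rpow (hreven : ∀ t, r (-t) = r t) (hr1 : ∀ t, |r t| ≤ 1) (hβ : β ≤ 0)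
    (hlim : Tendsto (fun t : ℝ => r t / t ^ β) atTop (nhds C)) :
    ∃ K, 0 ≤ K ∧ ∀ t, t ≠ 0 → |r t| ≤ K * |t| ^ β := by
  have h1 : ∀ᶠ t : ℝ in atTop, |r t / t ^ β| < |C| + 1 :=
    hlim.abs.eventually (gt_mem_nhds (lt_add_one _))
  obtain ⟨N, hN⟩ := eventually_atTop.1 (h1.and (eventually_ge_atTop 1))
  have hN1 : 1 ≤ N := (hN N le_rfl).2
  have hN0 : 0 < N := by linarith
  refine ⟨(|C| + 1) + N ^ (-β), by positivity, ?_⟩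
  have hpos : ∀ t : ℝ, 0 < t → |r t| ≤ ((|C| + 1) + N ^ (-β)) * t ^ β := by
    intro t ht
    have htβ := Real.rpow_pos_of_pos ht β
    have hNβ := Real.rpow_pos_of_pos hN0 (-β)
    rcases le_total N t with h | h
    · have := (hN t h).1
      rw [abs_div, abs_of_pos htβ, div_lt_iff₀ htβ] at this
      nlinarith [mul_pos hNβ htβ]
    · have h3 : N ^ β ≤ t ^ β := Real.rpow_le_rpow_of_nonpos ht h hβ
      have h4 : 1 ≤ N ^ (-β) * t ^ β := by
        calc 1 = N ^ (-β) * N ^ β := by rw [← Real.rpow_add hN0]; simp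
          _ ≤ _ := by gcongr
      have h5 := hr1 t
      have h6 : 0 ≤ (|C| + 1) * t ^ β := by positivity
      linarith [add_mul (|C| + 1) (N ^ (-β)) (t ^ β)]
  intro t ht
  rcases lt_or_gt_of_ne ht with h | h
  · rw [← hreven, abs_of_neg h]
    exact hpos _ (by linarith)
  · rw [abs_of_pos h]
    exact hpos _ h

lemma rpow_neg_mul_abs_comp_mul_le {K : ℝ} (hK : ∀ t, t ≠ 0 → |r t| ≤ K * |t| ^ β)
    {T z : ℝ} (hT : 0 < T) (hz : z ≠ 0) : T ^ (-β) * |r (T * z)| ≤ K * |z| ^ β := by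
  have h1 := hK (T * z) (mul_ne_zero hT.ne' hz)
  rw [abs_mul, abs_of_pos hT, Real.mul_rpow hT.le (abs_nonneg z)] at h1
  calc _ ≤ T ^ (-β) * (K * (T ^ β * |z| ^ β)) := by gcongr
    _ = (T ^ (-β) * T ^ β) * (K * |z| ^ β) := by ring
    _ = _ := by rw [← Real.rpow_add hT]; simp

lemma tendsto_integral_rpow_mul (hreven : ∀ t, r (-t) = r t) (hr1 : ∀ t, |r t| ≤ 1)
    (hβ0 : β < 0) (hβ1 : -1 < β) (hlim : Tendsto (fun t : ℝ => r t / t ^ β) atTop (nhds C))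
    {R : ℝ → ℝ × ℝ → ℝ} {L : ℝ × ℝ → ℝ} {κ : ℝ} (hκ : 0 ≤ κ)
    (hmeas : ∀ T, 0 < T → AEStronglyMeasurable (R T)
      ((volume.restrict (Set.Ioc (0 : ℝ) 1)).prod (volume.restrict (Set.Ioc (0 : ℝ) 1))))
    (hR : ∀ T, 0 < T → ∀ x y, 0 < x → 0 < y → |R T (x, y)| ≤ κ * |r (T * (x - y))|)
    (hL : ∀ x y, 0 < x → 0 < y → x ≠ y →
      Tendsto (fun T : ℝ => T ^ (-β) * R T (x, y)) atTop (nhds (L (x, y)))) :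
    Tendsto (fun T : ℝ => T ^ (-β) * ∫ q, R T q ∂((volume.restrict (Set.Ioc (0 : ℝ) 1)).prod
      (volume.restrict (Set.Ioc (0 : ℝ) 1)))) atTop
      (nhds (∫ q, L q ∂((volume.restrict (Set.Ioc (0 : ℝ) 1)).prod
        (volume.restrict (Set.Ioc (0 : ℝ) 1))))) := by
  obtain ⟨K, hK0, hK⟩ := exists_abs_le_rpow hreven hr1 hβ0.le hlim
  have hae : ∀ᵐ q ∂((volume.restrict (Set.Ioc (0 : ℝ) 1)).prod
      (volume.restrict (Set.Ioc (0 : ℝ) 1))), 0 < q.1 ∧ 0 < q.2 ∧ q.1 ≠ q.2 := by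
    have h1 : ∀ᵐ q ∂((volume.restrict (Set.Ioc (0 : ℝ) 1)).prod
        (volume.restrict (Set.Ioc (0 : ℝ) 1))), q ∈ Set.Ioc (0 : ℝ) 1 ×ˢ Set.Ioc (0 : ℝ) 1 := by
      rw [Measure.prod_restrict]
      exact ae_restrict_mem (measurableSet_Ioc.prod measurableSet_Ioc)
    filter_upwards [h1, ae_fst_ne_snd] with q h1 h2
    exact ⟨h1.1.1, h1.2.1, h2⟩
  simp_rw [← integral_const_mul]
  refine tendsto_integral_filter_of_dominated_convergence
    (fun q => κ * (K * |q.1 - q.2| ^ β)) ?_ ?_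
    (((integrable_abs_sub_rpow hβ1).const_mul _).const_mul _) ?_
  · filter_upwards [eventually_gt_atTop 0] with T hT
    exact (hmeas T hT).const_mul _
  · filter_upwards [eventually_gt_atTop 0] with T hT
    filter_upwards [hae] with q hq
    rw [norm_mul, Real.norm_of_nonneg (Real.rpow_nonneg hT.le _), Real.norm_eq_abs]
    calc _ ≤ T ^ (-β) * (κ * |r (T * (q.1 - q.2))|) := by
          gcongr
          exact hR T hT q.1 q.2 hq.1 hq.2.1
      _ = κ * (T ^ (-β) * |r (T * (q.1 - q.2))|) := by ring
      _ ≤ _ := mul_le_mul_of_nonneg_left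
          (rpow_neg_mul_abs_comp_mul_le hK hT (sub_ne_zero.2 hq.2.2)) hκ
  · filter_upwards [hae] with q hq
    exact hL q.1 q.2 hq.1 hq.2.1 hq.2.2

lemma tendsto_rpow_mul_comp_mul_sq (hreven : ∀ t, r (-t) = r t) (hβ0 : β < 0)
    (hlim : Tendsto (fun t : ℝ => r t / t ^ β) atTop (nhds C)) {z : ℝ} (hz : z ≠ 0) :
    Tendsto (fun T : ℝ => T ^ (-β) * r (T * z) ^ 2) atTop (nhds 0) := by
  have h1 := tendsto_rpow_mul_comp_mul hreven hlim hz
  have h2 : Tendsto (fun T : ℝ => T ^ β) atTop (nhds 0) := by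
    simpa using tendsto_rpow_neg_atTop (y := -β) (by linarith)
  have h3 := (h1.mul h1).mul h2
  rw [mul_zero] at h3
  refine h3.congr' ?_
  filter_upwards [eventually_gt_atTop 0] with T hT
  have : T ^ (-β) * T ^ β = 1 := by rw [← Real.rpow_add hT]; simp
  calc _ = (T ^ (-β) * T ^ β) * (T ^ (-β) * r (T * z) ^ 2) := by ring
    _ = _ := by rw [this, one_mul]

end LongRangeKernel

/-- A jointly measurable, centered, stationary Gaussian process with unit variance and covariance
function `r`. -/
structure IsStationaryGaussianProcess {Ω : Type*} [MeasurableSpace Ω] (P : Measure Ω)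
    (Y : ℝ → Ω → ℝ) (r : ℝ → ℝ) : Prop where
  measurable : Measurable (Function.uncurry Y)
  even : ∀ t, r (-t) = r t
  zero : r 0 = 1
  map_sum : ∀ (k : ℕ) (t c : Fin k → ℝ), (∀ i, 0 ≤ t i) →
    P.map (fun ω => ∑ i, c i * Y (t i) ω)
      = gaussianReal 0 (Real.toNNReal (∑ i, ∑ j, c i * c j * r (t i - t j)))

namespace IsStationaryGaussianProcess

lemma ae_mul_nonneg {T : ℝ} (hT : 0 ≤ T) :
    ∀ᵐ x ∂(volume.restrict (Set.Ioc (0 : ℝ) 1)), 0 ≤ T * x := by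
  filter_upwards [ae_restrict_mem measurableSet_Ioc] with x hx
  exact mul_nonneg hT hx.1.le

variable {Ω : Type*} [MeasurableSpace Ω] {P : Measure Ω} {Y : ℝ → Ω → ℝ} {r : ℝ → ℝ}

lemma measurable_apply (h : IsStationaryGaussianProcess P Y r) (t : ℝ) : Measurable (Y t) :=
  h.measurable.of_uncurry_left

lemma map_pair (h : IsStationaryGaussianProcess P Y r) {s t : ℝ} (hs : 0 ≤ s) (ht : 0 ≤ t)
    (c d : ℝ) : P.map (fun ω => c * Y s ω + d * Y t ω)
      = gaussianReal 0 (Real.toNNReal (c ^ 2 + 2 * c * d * r (s - t) + d ^ 2)) := by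
  have h1 := h.map_sum 2 ![s, t] ![c, d] (by intro i; fin_cases i <;> simpa)
  simp only [Fin.sum_univ_two, Matrix.cons_val_zero, Matrix.cons_val_one, sub_self, h.zero] at h1
  rw [h1, ← neg_sub s t, h.even]
  congr 2
  ring

lemma map_apply (h : IsStationaryGaussianProcess P Y r) {t : ℝ} (ht : 0 ≤ t) :
    P.map (Y t) = gaussianReal 0 1 := by
  have := h.map_pair ht ht 1 0
  simpa using this

lemma memLp_apply (h : IsStationaryGaussianProcess P Y r) {t : ℝ} (ht : 0 ≤ t) :
    MemLp (Y t) 2 P ∧ ∫ ω, Y t ω ^ 2 ∂P = 1 := by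
  simpa using integrable_sq_of_map_eq_gaussianReal (h.measurable_apply t) (h.map_apply ht)

lemma integral_mul (h : IsStationaryGaussianProcess P Y r) {s t : ℝ} (hs : 0 ≤ s) (ht : 0 ≤ t) :
    ∫ ω, Y s ω * Y t ω ∂P = r (s - t) ∧ |r (s - t)| ≤ 1 :=
  integral_mul_eq_of_gaussian_pair (h.measurable_apply s) (h.measurable_apply t)
    (h.map_pair hs ht)

lemma abs_cov_le_one (h : IsStationaryGaussianProcess P Y r) (t : ℝ) : |r t| ≤ 1 := by
  rcases le_total 0 t with ht | ht
  · simpa using (h.integral_mul ht le_rfl).2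
  · simpa [h.even] using (h.integral_mul le_rfl (neg_nonneg.2 ht)).2

lemma measurable_comp_scaled (h : IsStationaryGaussianProcess P Y r) (T : ℝ) :
    Measurable (Function.uncurry fun x ω => Y (T * x) ω) :=
  h.measurable.comp (by fun_prop : Measurable fun p : ℝ × Ω => (T * p.1, p.2))

variable [IsProbabilityMeasure P]

/-- The correlation of a function of Hermite rank two of a stationary Gaussian process is bounded
by the square of the covariance function. -/
lemma exists_abs_integral_comp_mul_le (h : IsStationaryGaussianProcess P Y r) {g : ℝ → ℝ}
    (hg : HasHermiteRankTwo g) :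
    ∃ K, 0 ≤ K ∧ ∀ s t, 0 ≤ s → 0 ≤ t → Integrable (fun ω => g (Y s ω) * g (Y t ω)) P ∧
      |∫ ω, g (Y s ω) * g (Y t ω) ∂P| ≤ K * r (s - t) ^ 2 := by
  obtain ⟨K, hK0, hK⟩ := hg.exists_abs_integral_prod_le
  have hgm := hg.measurable
  refine ⟨K, hK0, fun s t hs ht => ?_⟩
  have hs' := h.measurable_apply s
  have ht' := h.measurable_apply t
  have hmap := map_prodMk_eq_of_gaussian_pair hs' ht' (h.map_pair hs ht)
  have h1 := hK (r (s - t)) (h.abs_cov_le_one _)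
  have hgg : AEStronglyMeasurable (fun p : ℝ × ℝ => g p.1 * g p.2)
      (P.map fun ω => (Y s ω, Y t ω)) := by
    have : Measurable (fun p : ℝ × ℝ => g p.1 * g p.2) := by fun_prop
    exact this.aestronglyMeasurable
  have hpair : AEMeasurable (fun ω => (Y s ω, Y t ω)) P := by fun_prop
  have hInt : Integrable (fun p : ℝ × ℝ => g p.1 * g p.2) (P.map fun ω => (Y s ω, Y t ω)) := by
    rw [hmap] at hgg ⊢
    exact (integrable_map_measure hgg (by fun_prop)).2 h1.1
  refine ⟨(integrable_map_measure hgg hpair).1 hInt, ?_⟩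
  have e : ∫ ω, g (Y s ω) * g (Y t ω) ∂P
      = ∫ p, g p.1 * g p.2 ∂(P.map fun ω => (Y s ω, Y t ω)) :=
    (integral_map hpair hgg).symm
  rw [e]
  rw [hmap] at hgg ⊢
  rw [integral_map (by fun_prop) hgg]
  exact h1.2

lemma memLp_comp (h : IsStationaryGaussianProcess P Y r) {g : ℝ → ℝ}
    (hg : HasHermiteRankTwo g) :
    ∃ K, ∀ t, 0 ≤ t → MemLp (fun ω => g (Y t ω)) 2 P ∧ ∫ ω, g (Y t ω) ^ 2 ∂P ≤ K := by
  obtain ⟨K, hK0, hK⟩ := h.exists_abs_integral_comp_mul_le hg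
  refine ⟨K, fun t ht => ?_⟩
  obtain ⟨h1, h2⟩ := hK t t ht ht
  simp_rw [← sq] at h1 h2
  have hm : Measurable fun ω => g (Y t ω) := hg.measurable.comp (h.measurable_apply t)
  refine ⟨(memLp_two_iff_integrable_sq hm.aestronglyMeasurable).2 h1, ?_⟩
  have := le_of_abs_le h2
  simpa [h.zero] using this

lemma map_integral_scaled (h : IsStationaryGaussianProcess P Y r) {T : ℝ} (hT : 0 ≤ T) :
    MemLp (fun ω => ∫ x, Y (T * x) ω ∂(volume.restrict (Set.Ioc (0 : ℝ) 1))) 2 P ∧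
    P.map (fun ω => ∫ x, Y (T * x) ω ∂(volume.restrict (Set.Ioc (0 : ℝ) 1)))
      = gaussianReal 0 (Real.toNNReal
        (∫ ω, (∫ x, Y (T * x) ω ∂(volume.restrict (Set.Ioc (0 : ℝ) 1))) ^ 2 ∂P)) := by
  have hm := h.measurable_comp_scaled T
  have hb : ∀ᵐ x ∂(volume.restrict (Set.Ioc (0 : ℝ) 1)),
      MemLp (Y (T * x)) 2 P ∧ ∫ ω, Y (T * x) ω ^ 2 ∂P ≤ 1 := by
    filter_upwards [ae_mul_nonneg hT] with x hx
    exact ⟨(h.memLp_apply hx).1, (h.memLp_apply hx).2.le⟩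
  have hW : MemLp (fun ω => ∫ x, Y (T * x) ω ∂(volume.restrict (Set.Ioc (0 : ℝ) 1))) 2 P :=
    (memLp_two_iff_integrable_sq
      (hm.stronglyMeasurable.integral_prod_left).aestronglyMeasurable).2
      (integral_sq_integral_eq hm hb).1
  refine ⟨hW, map_integral_eq_gaussianReal (Y := fun x => Y (T * x)) hm ?_ ?_
    (memLp_two_uncurry hm hb) hW⟩
  · filter_upwards [ae_restrict_mem measurableSet_Ioc] with x hx using hx.1.le
  · exact fun k t c ht => ⟨_, h.map_sum k (fun i => T * t i) c fun i => mul_nonneg hT (ht i)⟩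

variable {β C : ℝ}

lemma tendsto_variance (h : IsStationaryGaussianProcess P Y r) (hβ0 : β < 0) (hβ1 : -1 < β)
    (hlim : Tendsto (fun t : ℝ => r t / t ^ β) atTop (nhds C)) :
    ∃ v : ℝ, Tendsto (fun T : ℝ => T ^ (-β) *
      ∫ ω, (∫ x, Y (T * x) ω ∂(volume.restrict (Set.Ioc (0 : ℝ) 1))) ^ 2 ∂P) atTop (nhds v) := by
  have hb : ∀ T : ℝ, 0 < T → ∀ᵐ x ∂(volume.restrict (Set.Ioc (0 : ℝ) 1)),
      MemLp (Y (T * x)) 2 P ∧ ∫ ω, Y (T * x) ω ^ 2 ∂P ≤ 1 := by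
    intro T hT
    filter_upwards [ae_mul_nonneg hT.le] with x hx
    exact ⟨(h.memLp_apply hx).1, (h.memLp_apply hx).2.le⟩
  have hcov : ∀ T x y : ℝ, 0 < T → 0 < x → 0 < y →
      ∫ ω, Y (T * x) ω * Y (T * y) ω ∂P = r (T * (x - y)) := by
    intro T x y hT hx hy
    rw [(h.integral_mul (by positivity) (by positivity)).1, mul_sub]
  have key := tendsto_integral_rpow_mul (κ := 1)
    (R := fun T q => ∫ ω, Y (T * q.1) ω * Y (T * q.2) ω ∂P)
    (L := fun q => C * |q.1 - q.2| ^ β) h.even h.abs_cov_le_one hβ0 hβ1 hlim zero_le_one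
    (fun T hT => (integral_sq_integral_eq (h.measurable_comp_scaled T) (hb T hT)).2.1)
    (fun T hT x y hx hy => by rw [hcov T x y hT hx hy, one_mul])
    (fun x y hx hy hxy => by
      refine (tendsto_rpow_mul_comp_mul h.even hlim (sub_ne_zero.2 hxy)).congr' ?_
      filter_upwards [eventually_gt_atTop 0] with T hT
      rw [hcov T x y hT hx hy])
  refine ⟨_, key.congr' ?_⟩
  filter_upwards [eventually_gt_atTop 0] with T hT
  rw [(integral_sq_integral_eq (h.measurable_comp_scaled T) (hb T hT)).2.2]

lemma integrable_sq_integral_comp (h : IsStationaryGaussianProcess P Y r) {g : ℝ → ℝ}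
    (hg : HasHermiteRankTwo g) {T : ℝ} (hT : 0 ≤ T) :
    Integrable (fun ω => (∫ x, g (Y (T * x) ω) ∂(volume.restrict (Set.Ioc (0 : ℝ) 1))) ^ 2) P := by
  obtain ⟨K', hK'⟩ := h.memLp_comp hg
  refine (integral_sq_integral_eq (G := fun x ω => g (Y (T * x) ω)) (K := K')
    (hg.measurable.comp (h.measurable_comp_scaled T)) ?_).1
  filter_upwards [ae_mul_nonneg hT] with x hx using hK' _ hx

lemma tendsto_integral_sq_comp (h : IsStationaryGaussianProcess P Y r) {g : ℝ → ℝ}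
    (hg : HasHermiteRankTwo g) (hβ0 : β < 0) (hβ1 : -1 < β)
    (hlim : Tendsto (fun t : ℝ => r t / t ^ β) atTop (nhds C)) :
    Tendsto (fun T : ℝ => T ^ (-β) *
      ∫ ω, (∫ x, g (Y (T * x) ω) ∂(volume.restrict (Set.Ioc (0 : ℝ) 1))) ^ 2 ∂P)
      atTop (nhds 0) := by
  obtain ⟨K, hK0, hK⟩ := h.exists_abs_integral_comp_mul_le hg
  obtain ⟨K', hK'⟩ := h.memLp_comp hg
  have hm : ∀ T : ℝ, Measurable (Function.uncurry fun x ω => g (Y (T * x) ω)) := fun T =>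
    hg.measurable.comp (h.measurable_comp_scaled T)
  have hb : ∀ T : ℝ, 0 < T → ∀ᵐ x ∂(volume.restrict (Set.Ioc (0 : ℝ) 1)),
      MemLp (fun ω => g (Y (T * x) ω)) 2 P ∧ ∫ ω, g (Y (T * x) ω) ^ 2 ∂P ≤ K' := by
    intro T hT
    filter_upwards [ae_mul_nonneg hT.le] with x hx using hK' _ hx
  have hcov : ∀ T x y : ℝ, 0 < T → 0 < x → 0 < y →
      |∫ ω, g (Y (T * x) ω) * g (Y (T * y) ω) ∂P| ≤ K * r (T * (x - y)) ^ 2 := by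
    intro T x y hT hx hy
    rw [mul_sub]
    exact (hK _ _ (by positivity) (by positivity)).2
  have key := tendsto_integral_rpow_mul (κ := K)
    (R := fun T q => ∫ ω, g (Y (T * q.1) ω) * g (Y (T * q.2) ω) ∂P)
    (L := fun _ => 0) h.even h.abs_cov_le_one hβ0 hβ1 hlim hK0
    (fun T hT => (integral_sq_integral_eq (hm T) (hb T hT)).2.1)
    (fun T hT x y hx hy => by
      refine (hcov T x y hT hx hy).trans (mul_le_mul_of_nonneg_left ?_ hK0)
      rw [← sq_abs]
      nlinarith [h.abs_cov_le_one (T * (x - y)), abs_nonneg (r (T * (x - y)))])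
    (fun x y hx hy hxy => by
      have h1 := (tendsto_rpow_mul_comp_mul_sq h.even hβ0 hlim (sub_ne_zero.2 hxy)).const_mul K
      rw [mul_zero] at h1
      refine squeeze_zero_norm' ?_ h1
      filter_upwards [eventually_gt_atTop 0] with T hT
      rw [norm_mul, Real.norm_of_nonneg (Real.rpow_nonneg hT.le _), Real.norm_eq_abs]
      calc _ ≤ T ^ (-β) * (K * r (T * (x - y)) ^ 2) :=
            mul_le_mul_of_nonneg_left (hcov T x y hT hx hy) (Real.rpow_nonneg hT.le _)
        _ = _ := by ring)
  rw [integral_zero] at key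
  refine key.congr' ?_
  filter_upwards [eventually_gt_atTop 0] with T hT
  rw [(integral_sq_integral_eq (hm T) (hb T hT)).2.2]

end IsStationaryGaussianProcess

section DeltaMethod

lemma abs_sqrt_abs_sub_le {s D : ℝ} (hs : 0 < s) :
    |√|D| - s - (D - s ^ 2) / (2 * s)| ≤ (D - s ^ 2) ^ 2 / (2 * s ^ 3) := by
  set q := √|D| with hq
  have hq0 : 0 ≤ q := Real.sqrt_nonneg _
  have hq2 : q ^ 2 = |D| := Real.sq_sqrt (abs_nonneg D)
  rcases le_total 0 D with hD | hD
  · rw [abs_of_nonneg hD] at hq2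
    have e1 : q - s - (D - s ^ 2) / (2 * s) = -((q - s) ^ 2 / (2 * s)) := by
      rw [← hq2]; field_simp; ring
    have e2 : (D - s ^ 2) ^ 2 / (2 * s ^ 3) = (q - s) ^ 2 / (2 * s) * ((q + s) / s) ^ 2 := by
      rw [← hq2]; field_simp; ring
    rw [e1, e2, abs_neg, abs_of_nonneg (by positivity)]
    have : 1 ≤ (q + s) / s := by rw [le_div_iff₀ hs]; linarith
    exact le_mul_of_one_le_right (by positivity) (one_le_pow₀ this)
  · rw [abs_of_nonpos hD] at hq2
    have hD' : D = -q ^ 2 := by linarith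
    have e1 : q - s - (D - s ^ 2) / (2 * s) = (q ^ 2 * s ^ 2 + 2 * s ^ 3 * q - s ^ 4) / (2 * s ^ 3) := by
      rw [hD']; field_simp; ring
    rw [e1, abs_div, abs_of_pos (by positivity : 0 < 2 * s ^ 3)]
    gcongr
    rw [hD', abs_le]
    constructor
    · nlinarith [sq_nonneg (q ^ 2), mul_nonneg (pow_nonneg hs.le 3) hq0, sq_nonneg (q * s)]
    · nlinarith [sq_nonneg (q ^ 2), sq_nonneg (s * (q - s)), sq_nonneg (q * s),
        mul_nonneg (sq_nonneg s) (sq_nonneg (q - s))]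

lemma sub_sub_sq_le (x y z : ℝ) : (x - y - z) ^ 2 ≤ 3 * (x ^ 2 + y ^ 2 + z ^ 2) := by
  nlinarith [sq_nonneg (x + y), sq_nonneg (x + z), sq_nonneg (y - z)]

set_option maxHeartbeats 1000000 in
/-- Quantitative linearization of the moment estimators. -/
lemma exists_delta_method_bound (a b μ₁ μ₂ σ : ℝ) {s : ℝ} (hs : 0 < s)
    (hμ : 4 * μ₂ - 2 * π * μ₁ ^ 2 = s ^ 2) :
    ∃ K, 0 ≤ K ∧ ∀ δ Z R₁ R₂ : ℝ, 0 < δ → δ ≤ 1 →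
      |δ⁻¹ * (σ * (μ₁ + δ * (a * Z + R₁))
          + 1 / 2 * √|4 * (μ₂ + δ * (b * Z + R₂)) - 2 * π * (μ₁ + δ * (a * Z + R₁)) ^ 2|
          - (σ * μ₁ + s / 2)) - (σ * a + (b - π * μ₁ * a) / s) * Z|
        ≤ K * (√(R₁ ^ 2 + R₂ ^ 2 + δ * Z ^ 2) + (R₁ ^ 2 + R₂ ^ 2 + δ * Z ^ 2)
          + (R₁ ^ 2 + R₂ ^ 2 + δ * Z ^ 2) ^ 2) := by
  set A := 2 * a ^ 2 + 2 * b ^ 2 + 2 with hA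
  have hA0 : 0 < A := by positivity
  set k₁ := |σ| + |π * μ₁| / s + 1 / s with hk₁
  set k₂ := π / (2 * s) * A + (48 + 48 * π ^ 2 * μ₁ ^ 2) * A / (4 * s ^ 3) with hk₂
  set k₃ := 12 * π ^ 2 * A ^ 2 / (4 * s ^ 3) with hk₃
  have hπ := Real.pi_pos
  have hk₁0 : 0 ≤ k₁ := by positivity
  have hk₂0 : 0 ≤ k₂ := by positivity
  have hk₃0 : 0 ≤ k₃ := by positivity
  refine ⟨k₁ + k₂ + k₃, by positivity, fun δ Z R₁ R₂ hδ hδ1 => ?_⟩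
  set Q := R₁ ^ 2 + R₂ ^ 2 + δ * Z ^ 2 with hQ
  set U := a * Z + R₁ with hU
  set V := b * Z + R₂ with hV
  have hδZ : 0 ≤ δ * Z ^ 2 := by positivity
  have hQ0 : 0 ≤ Q := by positivity
  have hsq := Real.sqrt_nonneg Q
  have hR1 : |R₁| ≤ √Q := Real.abs_le_sqrt (by linarith [sq_nonneg R₂])
  have hR2 : |R₂| ≤ √Q := Real.abs_le_sqrt (by linarith [sq_nonneg R₁])
  have hδR1 : δ * R₁ ^ 2 ≤ R₁ ^ 2 := mul_le_of_le_one_left (sq_nonneg _) hδ1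
  have hδR2 : δ * R₂ ^ 2 ≤ R₂ ^ 2 := mul_le_of_le_one_left (sq_nonneg _) hδ1
  have hlin : ∀ c R : ℝ, δ * R ^ 2 ≤ R ^ 2 → R ^ 2 + δ * Z ^ 2 ≤ Q → c ^ 2 * 2 + 2 ≤ A →
      δ * (c * Z + R) ^ 2 ≤ A * Q := by
    intro c R h1 h2 h3
    have h4 : δ * (c * Z + R) ^ 2 ≤ 2 * c ^ 2 * (δ * Z ^ 2) + 2 * (δ * R ^ 2) := by
      linarith [mul_nonneg hδ.le (sq_nonneg (c * Z - R)),
        (by ring : 2 * c ^ 2 * (δ * Z ^ 2) + 2 * (δ * R ^ 2) - δ * (c * Z + R) ^ 2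
          = δ * (c * Z - R) ^ 2)]
    have h5 : 2 * c ^ 2 * (δ * Z ^ 2) ≤ 2 * c ^ 2 * Q :=
      mul_le_mul_of_nonneg_left (by linarith [sq_nonneg R]) (by positivity)
    have h6 : (c ^ 2 * 2 + 2) * Q ≤ A * Q := mul_le_mul_of_nonneg_right h3 hQ0
    linarith
  have hUQ : δ * U ^ 2 ≤ A * Q :=
    hlin a R₁ hδR1 (by linarith [sq_nonneg R₂]) (by linarith [sq_nonneg b])
  have hVQ : δ * V ^ 2 ≤ A * Q :=
    hlin b R₂ hδR2 (by linarith [sq_nonneg R₁]) (by linarith [sq_nonneg a])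
  have hU0 : 0 ≤ δ * U ^ 2 := by positivity
  set D := 4 * (μ₂ + δ * V) - 2 * π * (μ₁ + δ * U) ^ 2 with hD
  set L := 4 * V - 4 * π * μ₁ * U - 2 * π * (δ * U ^ 2) with hL
  have hDL : D - s ^ 2 = δ * L := by rw [hD, hL, ← hμ]; ring
  set E := √|D| - s - (D - s ^ 2) / (2 * s) with hE
  have hEb : |E| ≤ (D - s ^ 2) ^ 2 / (2 * s ^ 3) := abs_sqrt_abs_sub_le hs
  have hdec : δ⁻¹ * (σ * (μ₁ + δ * U) + 1 / 2 * √|D| - (σ * μ₁ + s / 2))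
        - (σ * a + (b - π * μ₁ * a) / s) * Z
      = σ * R₁ + R₂ / s - π * μ₁ * R₁ / s - π / (2 * s) * (δ * U ^ 2) + δ⁻¹ * E / 2 := by
    have h1 : √|D| = E + s + δ * L / (2 * s) := by rw [hE, hDL]; ring
    rw [h1, hL, hU, hV]
    field_simp
    ring
  have hδL : δ * L ^ 2 ≤ (48 + 48 * π ^ 2 * μ₁ ^ 2) * A * Q + 12 * π ^ 2 * A ^ 2 * Q ^ 2 := by
    have h1 : L ^ 2 ≤ 48 * V ^ 2 + 48 * π ^ 2 * μ₁ ^ 2 * U ^ 2 + 12 * π ^ 2 * (δ * U ^ 2) ^ 2 := by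
      calc L ^ 2 ≤ _ := sub_sub_sq_le _ _ _
        _ = _ := by ring
    have h2 : (δ * U ^ 2) ^ 2 ≤ (A * Q) ^ 2 := by gcongr
    have h3 : δ * (δ * U ^ 2) ^ 2 ≤ (A * Q) ^ 2 :=
      (mul_le_of_le_one_left (sq_nonneg _) hδ1).trans h2
    have h4 := mul_le_mul_of_nonneg_left h1 hδ.le
    have h5 := mul_le_mul_of_nonneg_left hUQ (by positivity : 0 ≤ 48 * π ^ 2 * μ₁ ^ 2)
    have h6 := mul_le_mul_of_nonneg_left h3 (by positivity : 0 ≤ 12 * π ^ 2)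
    linarith
  have hEfin : |δ⁻¹ * E / 2| ≤ ((48 + 48 * π ^ 2 * μ₁ ^ 2) * A * Q + 12 * π ^ 2 * A ^ 2 * Q ^ 2)
      / (4 * s ^ 3) := by
    rw [abs_div, abs_mul, abs_of_pos (inv_pos.2 hδ), abs_of_pos (by norm_num : (0 : ℝ) < 2)]
    calc _ ≤ δ⁻¹ * ((D - s ^ 2) ^ 2 / (2 * s ^ 3)) / 2 := by gcongr
      _ = δ * L ^ 2 / (4 * s ^ 3) := by rw [hDL]; field_simp; ring
      _ ≤ _ := by gcongr
  rw [hdec]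
  have t1 : |σ * R₁| ≤ |σ| * √Q := by rw [abs_mul]; gcongr
  have t2 : |R₂ / s| ≤ 1 / s * √Q := by
    rw [abs_div, abs_of_pos hs, one_div, inv_mul_eq_div]; gcongr
  have t3 : |π * μ₁ * R₁ / s| ≤ |π * μ₁| / s * √Q := by
    rw [abs_div, abs_of_pos hs, abs_mul, div_mul_eq_mul_div]; gcongr
  have t4 : |π / (2 * s) * (δ * U ^ 2)| ≤ π / (2 * s) * (A * Q) := by
    rw [abs_mul, abs_of_pos (by positivity), abs_of_nonneg hU0]; gcongr
  have e1 : ((48 + 48 * π ^ 2 * μ₁ ^ 2) * A * Q + 12 * π ^ 2 * A ^ 2 * Q ^ 2) / (4 * s ^ 3)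
      + π / (2 * s) * (A * Q) = k₂ * Q + k₃ * Q ^ 2 := by
    rw [hk₂, hk₃]; ring
  have e2 : |σ| * √Q + 1 / s * √Q + |π * μ₁| / s * √Q = k₁ * √Q := by rw [hk₁]; ring
  calc _ ≤ |σ * R₁| + |R₂ / s| + |π * μ₁ * R₁ / s| + |π / (2 * s) * (δ * U ^ 2)|
        + |δ⁻¹ * E / 2| := by
        refine (abs_add_le _ _).trans (add_le_add_left ?_ _)
        refine (abs_sub _ _).trans (add_le_add_left ?_ _)
        refine (abs_sub _ _).trans (add_le_add_left ?_ _)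
        exact abs_add_le _ _
    _ ≤ k₁ * √Q + k₂ * Q + k₃ * Q ^ 2 := by linarith
    _ ≤ _ := by
        have := mul_nonneg hk₁0 hQ0
        have := mul_nonneg hk₁0 (sq_nonneg Q)
        have := mul_nonneg hk₂0 hsq
        have := mul_nonneg hk₂0 (sq_nonneg Q)
        have := mul_nonneg hk₃0 hsq
        have := mul_nonneg hk₃0 hQ0
        linarith [(by ring : (k₁ + k₂ + k₃) * (√Q + Q + Q ^ 2)
          = k₁ * √Q + k₁ * Q + k₁ * Q ^ 2 + (k₂ * √Q + k₂ * Q + k₂ * Q ^ 2)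
            + (k₃ * √Q + k₃ * Q + k₃ * Q ^ 2))]

end DeltaMethod

section GaussianApproximation

variable {Ω : Type*} [MeasurableSpace Ω] {P : Measure Ω} [IsProbabilityMeasure P]

/-- Random vectors which are dominated by a function, continuous and vanishing at `0`, of
variables tending to zero in mean tend to zero in measure. -/
lemma tendstoInMeasure_sub_of_integral_tendsto {E : Type*} [SeminormedAddCommGroup E]
    {F G : ℝ → Ω → E} {Q : ℝ → Ω → ℝ} {φ : ℝ → ℝ} (hφ : Continuous φ) (hφ0 : φ 0 = 0)
    (hQ0 : ∀ T ω, 0 ≤ T → 0 ≤ Q T ω) (hQint : ∀ᶠ T in atTop, Integrable (Q T) P)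
    (hQ : Tendsto (fun T => ∫ ω, Q T ω ∂P) atTop (nhds 0))
    (hbound : ∀ᶠ T in atTop, ∀ᵐ ω ∂P, ‖F T ω - G T ω‖ ≤ φ (Q T ω)) :
    TendstoInMeasure P (F - G) atTop 0 := by
  rw [tendstoInMeasure_iff_measureReal_norm]
  intro ε hε
  have h1 : ∀ᶠ x in nhds (0 : ℝ), φ x < ε := by
    have := hφ.tendsto 0
    rw [hφ0] at this
    exact this.eventually (gt_mem_nhds hε)
  obtain ⟨η, hη, hη'⟩ := Metric.eventually_nhds_iff.1 h1
  have h2 : Tendsto (fun T => η⁻¹ * ∫ ω, Q T ω ∂P) atTop (nhds 0) := by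
    simpa using hQ.const_mul η⁻¹
  refine squeeze_zero' (Eventually.of_forall fun T => measureReal_nonneg) ?_ h2
  filter_upwards [hQint, hbound, eventually_ge_atTop 0] with T hT hb hT0
  have h3 := mul_meas_ge_le_integral_of_nonneg
    (ae_of_all _ fun ω => hQ0 T ω hT0 : 0 ≤ᵐ[P] Q T) hT η
  rw [inv_mul_eq_div, le_div_iff₀ hη, mul_comm]
  refine (mul_le_mul_of_nonneg_left ?_ hη.le).trans h3
  refine ENNReal.toReal_mono (measure_ne_top _ _) (measure_mono_ae ?_)
  filter_upwards [hb] with ω hω h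
  change ε ≤ _ at h
  change η ≤ Q T ω
  by_contra! hlt
  have h4 := hη' (y := Q T ω) (by rwa [Real.dist_eq, sub_zero, abs_of_nonneg (hQ0 T ω hT0)])
  simp only [Pi.sub_apply, Pi.zero_apply, sub_zero] at h
  linarith

lemma gaussianReal_toNNReal_eq_map {v : ℝ} (hv : 0 ≤ v) :
    gaussianReal 0 v.toNNReal = (gaussianReal 0 1).map (fun x => √v * x) := by
  rw [gaussianReal_map_const_mul, mul_zero, mul_one]
  congr 1
  apply NNReal.coe_injective
  rw [Real.coe_toNNReal _ hv, NNReal.coe_mk, Real.sq_sqrt hv]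

lemma tendsto_integral_gaussianReal_toNNReal {V : ℝ → ℝ} {v : ℝ} (hV0 : ∀ᶠ T in atTop, 0 ≤ V T)
    (hV : Tendsto V atTop (nhds v)) (f : BoundedContinuousFunction ℝ ℝ) :
    Tendsto (fun T => ∫ x, f x ∂(gaussianReal 0 (V T).toNNReal)) atTop
      (nhds (∫ x, f x ∂(gaussianReal 0 v.toNNReal))) := by
  have hv : 0 ≤ v := ge_of_tendsto hV hV0
  have e : ∀ u, 0 ≤ u → ∫ x, f x ∂(gaussianReal 0 u.toNNReal)
      = ∫ x, f (√u * x) ∂(gaussianReal 0 1) := by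
    intro u hu
    rw [gaussianReal_toNNReal_eq_map hu,
      integral_map (by fun_prop) f.continuous.measurable.aestronglyMeasurable]
  rw [e v hv]
  have h1 : Tendsto (fun T => ∫ x, f (√(V T) * x) ∂(gaussianReal 0 1)) atTop
      (nhds (∫ x, f (√v * x) ∂(gaussianReal 0 1))) := by
    refine tendsto_integral_filter_of_dominated_convergence (fun _ => ‖f‖) ?_ ?_
      (integrable_const _) ?_
    · refine Eventually.of_forall fun T => ?_
      exact (f.continuous.comp (by fun_prop)).measurable.aestronglyMeasurable
    · exact Eventually.of_forall fun T => ae_of_all _ fun x => f.norm_coe_le_norm _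
    · refine ae_of_all _ fun x => ?_
      exact (f.continuous.tendsto _).comp
        (((Real.continuous_sqrt.tendsto v).comp hV).mul_const x)
  refine h1.congr' ?_
  filter_upwards [hV0] with T hT using (e _ hT).symm

/-- Random vectors close to multiples of Gaussian variables with converging variances are
asymptotically Gaussian. -/
lemma tendsto_integral_of_gaussian_approx {Z : ℝ → Ω → ℝ} {V : ℝ → ℝ} {v w₁ w₂ : ℝ}
    (hZ : ∀ T, Measurable (Z T)) (hV0 : ∀ᶠ T in atTop, 0 ≤ V T)
    (hZV : ∀ᶠ T in atTop, P.map (Z T) = gaussianReal 0 (V T).toNNReal)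
    (hV : Tendsto V atTop (nhds v)) {F : ℝ → Ω → ℝ × ℝ} (hF : ∀ T, Measurable (F T))
    (hFZ : TendstoInMeasure P (F - fun T ω => (w₁ * Z T ω, w₂ * Z T ω)) atTop 0)
    (f : BoundedContinuousFunction (ℝ × ℝ) ℝ) :
    Tendsto (fun T => ∫ ω, f (F T ω) ∂P) atTop
      (nhds (∫ x, f x ∂((gaussianReal 0 v.toNNReal).map fun x => (w₁ * x, w₂ * x)))) := by
  have hG : ∀ T, Measurable fun ω => (w₁ * Z T ω, w₂ * Z T ω) := fun T => by
    have := hZ T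
    fun_prop
  have hlim : TendstoInDistribution (fun T ω => (w₁ * Z T ω, w₂ * Z T ω)) atTop
      (fun x : ℝ => (w₁ * x, w₂ * x)) (fun _ => P) (gaussianReal 0 v.toNNReal) := by
    refine ⟨fun T => (hG T).aemeasurable, by fun_prop, ?_⟩
    refine ProbabilityMeasure.tendsto_iff_forall_integral_tendsto.2 fun g => ?_
    have hgm := g.continuous.measurable
    have h1 := tendsto_integral_gaussianReal_toNNReal hV0 hV
      (g.compContinuous ⟨fun x : ℝ => (w₁ * x, w₂ * x), by fun_prop⟩)
    change Tendsto (fun T => ∫ y, g y ∂(P.map fun ω => (w₁ * Z T ω, w₂ * Z T ω))) atTop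
      (nhds (∫ y, g y ∂((gaussianReal 0 v.toNNReal).map fun x => (w₁ * x, w₂ * x))))
    rw [integral_map (by fun_prop) hgm.aestronglyMeasurable]
    refine h1.congr' ?_
    filter_upwards [hZV] with T hT
    rw [integral_map (hG T).aemeasurable hgm.aestronglyMeasurable, ← hT,
      integral_map (hZ T).aemeasurable]
    · rfl
    · exact (BoundedContinuousFunction.continuous _).measurable.aestronglyMeasurable
  have h2 := tendstoInDistribution_of_tendstoInMeasure_sub F _ hlim hFZ
    fun T => (hF T).aemeasurable
  have h3 := (ProbabilityMeasure.tendsto_iff_forall_integral_tendsto.1 h2.tendsto) f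
  refine h3.congr fun T => ?_
  exact integral_map (hF T).aemeasurable f.continuous.measurable.aestronglyMeasurable

end GaussianApproximation

lemma one_div_mul_setIntegral_Ioc {T : ℝ} (hT : 0 < T) (f : ℝ → ℝ) :
    (1 / T) * ∫ u in Set.Ioc (0 : ℝ) T, f u = ∫ x in Set.Ioc (0 : ℝ) 1, f (T * x) := by
  rw [← intervalIntegral.integral_of_le hT.le, ← intervalIntegral.integral_of_le zero_le_one]
  have := intervalIntegral.mul_integral_comp_mul_left (a := 0) (b := 1) (f := f) T
  rw [mul_zero, mul_one] at this
  rw [← this]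
  field_simp

lemma IsStationaryGaussianProcess.ae_integral_comp_eq {Ω : Type*} [MeasurableSpace Ω]
    {P : Measure Ω} [IsProbabilityMeasure P] {Y : ℝ → Ω → ℝ} {r : ℝ → ℝ}
    (h : IsStationaryGaussianProcess P Y r) {g φ : ℝ → ℝ} (hg : HasHermiteRankTwo g) {m a : ℝ}
    (hφ : ∀ y, φ y = m + a * y + g y) {T : ℝ} (hT : 0 ≤ T) :
    ∀ᵐ ω ∂P, ∫ x in Set.Ioc (0 : ℝ) 1, φ (Y (T * x) ω)
      = m + a * (∫ x in Set.Ioc (0 : ℝ) 1, Y (T * x) ω)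
        + ∫ x in Set.Ioc (0 : ℝ) 1, g (Y (T * x) ω) := by
  obtain ⟨K, hK⟩ := h.memLp_comp hg
  have hm := h.measurable_comp_scaled T
  have h1 : MemLp (Function.uncurry fun x ω => Y (T * x) ω) 2
      ((volume.restrict (Set.Ioc (0 : ℝ) 1)).prod P) := by
    refine memLp_two_uncurry hm (K := 1) ?_
    filter_upwards [ae_mul_nonneg hT] with x hx
    exact ⟨(h.memLp_apply hx).1, (h.memLp_apply hx).2.le⟩
  have h2 : MemLp (Function.uncurry fun x ω => g (Y (T * x) ω)) 2
      ((volume.restrict (Set.Ioc (0 : ℝ) 1)).prod P) := by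
    refine memLp_two_uncurry (hg.measurable.comp hm) (K := K) ?_
    filter_upwards [ae_mul_nonneg hT] with x hx using hK _ hx
  filter_upwards [(h1.integrable one_le_two).prod_left_ae,
    (h2.integrable one_le_two).prod_left_ae] with ω i1 i2
  simp only [Function.uncurry] at i1 i2
  simp_rw [hφ]
  have i3 : Integrable (fun x => m + a * Y (T * x) ω) (volume.restrict (Set.Ioc (0 : ℝ) 1)) :=
    (integrable_const m).add (i1.const_mul a)
  rw [integral_add i3 i2, integral_add (integrable_const m) (i1.const_mul a),
    integral_const_mul]
  simp

lemma posSemidef_rankOne {v : ℝ} (hv : 0 ≤ v) (w₁ w₂ : ℝ) :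
    (!![v * w₁ ^ 2, v * (w₁ * w₂); v * (w₁ * w₂), v * w₂ ^ 2]
      : Matrix (Fin 2) (Fin 2) ℝ).PosSemidef := by
  have h := (Matrix.posSemidef_vecMulVec_self_star (R := ℝ) ![w₁, w₂]).smul hv
  convert h using 1
  ext i j
  fin_cases i <;> fin_cases j <;> simp [-mul_eq_mul_left_iff] <;> ring

lemma map_linear_gaussianReal_prod {v : ℝ} (hv : 0 ≤ v) (w₁ w₂ c d : ℝ) :
    ((gaussianReal 0 v.toNNReal).map fun x : ℝ => (w₁ * x, w₂ * x)).map
        (fun x => c * x.1 + d * x.2)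
      = gaussianReal 0 (Real.toNNReal (c ^ 2 * (v * w₁ ^ 2) + 2 * c * d * (v * (w₁ * w₂))
        + d ^ 2 * (v * w₂ ^ 2))) := by
  rw [Measure.map_map (by fun_prop) (by fun_prop)]
  have e : ((fun x : ℝ × ℝ => c * x.1 + d * x.2) ∘ fun x : ℝ => (w₁ * x, w₂ * x))
      = fun x => (c * w₁ + d * w₂) * x := by
    ext x; simp only [Function.comp]; ring
  have e' : c ^ 2 * (v * w₁ ^ 2) + 2 * c * d * (v * (w₁ * w₂)) + d ^ 2 * (v * w₂ ^ 2)
      = (c * w₁ + d * w₂) ^ 2 * v := by ring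
  rw [e, gaussianReal_map_const_mul, mul_zero, e']
  congr 1
  apply NNReal.coe_injective
  rw [Real.coe_toNNReal _ (by positivity), NNReal.coe_mul, NNReal.coe_mk, Real.coe_toNNReal _ hv]


/-- Theorem 3.4, case (3): asymptotic normality of the parameter estimators
`α̂₊(T)`, `α̂₋(T)` under long-range dependence (`r(t)/t^{2H-2} → C`, `H ∈ (1/2, 1)`). Convergence in
distribution is expressed via bounded continuous test functions, and the limiting
centered bivariate Gaussian law is characterised by the Gaussianity of all its
linear functionals. -/
theorem parameter_estimator_clt_long_range
    {Ω : Type*} [MeasurableSpace Ω] (P : Measure Ω) [IsProbabilityMeasure P]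
    (Y : ℝ → Ω → ℝ) (hYmeas : Measurable (Function.uncurry Y))
    (r : ℝ → ℝ) (hreven : ∀ t, r (-t) = r t) (hr0 : r 0 = 1)
    (hGauss : ∀ (k : ℕ) (t c : Fin k → ℝ), (∀ i, 0 ≤ t i) →
      P.map (fun ω => ∑ i, c i * Y (t i) ω)
        = gaussianReal 0 (Real.toNNReal (∑ i, ∑ j, c i * c j * r (t i - t j))))
    (H : ℝ) (hH : H ∈ Set.Ioo (1 / 2 : ℝ) 1) (C : ℝ)
    (hrlim : Tendsto (fun t : ℝ => r t / t ^ (2 * H - 2)) atTop (nhds C))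
    (αp αm : ℝ) (hαp : 0 < αp) (hαm : 0 < αm) (hne : αp ≠ αm)
    (X : ℝ → Ω → ℝ)
    (hX : ∀ t ω, X t ω = αp * Y t ω * (if 0 < Y t ω then (1 : ℝ) else 0)
            + αm * Y t ω * (if Y t ω < 0 then (1 : ℝ) else 0))
    (m1 m2 : ℝ → Ω → ℝ)
    (hm1 : ∀ T ω, m1 T ω = (1 / T) * ∫ u in Set.Ioc (0 : ℝ) T, X u ω)
    (hm2 : ∀ T ω, m2 T ω = (1 / T) * ∫ u in Set.Ioc (0 : ℝ) T, (X u ω) ^ 2)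
    (aPlus aMinus : ℝ → Ω → ℝ)
    (haPlus : ∀ T ω, aPlus T ω
      = Real.sqrt (π / 2) * m1 T ω
        + (1 / 2) * Real.sqrt |4 * m2 T ω - 2 * π * (m1 T ω) ^ 2|)
    (haMinus : ∀ T ω, aMinus T ω
      = -Real.sqrt (π / 2) * m1 T ω
        + (1 / 2) * Real.sqrt |4 * m2 T ω - 2 * π * (m1 T ω) ^ 2|) :
    ∃ S : Matrix (Fin 2) (Fin 2) ℝ, S.PosSemidef ∧
      ∃ μ : Measure (ℝ × ℝ), IsProbabilityMeasure μ ∧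
        (∀ c d : ℝ, μ.map (fun x => c * x.1 + d * x.2)
          = gaussianReal 0
              (Real.toNNReal (c ^ 2 * S 0 0 + 2 * c * d * S 0 1 + d ^ 2 * S 1 1)))
        ∧ ∀ f : BoundedContinuousFunction (ℝ × ℝ) ℝ,
            Tendsto (fun T : ℝ =>
                ∫ ω, f (T ^ (1 - H) * (aPlus T ω - αp),
                        T ^ (1 - H) * (aMinus T ω - αm)) ∂P)
              atTop (nhds (∫ x, f x ∂μ)) := by
  have hY : IsStationaryGaussianProcess P Y r := ⟨hYmeas, hreven, hr0, hGauss⟩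
  set β : ℝ := 2 * H - 2 with hβ
  have hβ0 : β < 0 := by linarith [hH.2]
  have hβ1 : -1 < β := by linarith [hH.1]
  set p : ℝ := √(2 / π) with hp
  have hπ := Real.pi_pos
  have hp2 : p ^ 2 * π = 2 := by
    rw [hp, Real.sq_sqrt (by positivity)]; field_simp
  have hσp : √(π / 2) * p = 1 := by
    rw [hp, ← Real.sqrt_mul (by positivity), Real.sqrt_eq_one]; field_simp
  set a : ℝ := (αp + αm) / 2 with ha
  set b : ℝ := (αp ^ 2 - αm ^ 2) * p with hb
  set μ₁ : ℝ := (αp - αm) / 2 * p with hμ₁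
  set μ₂ : ℝ := (αp ^ 2 + αm ^ 2) / 2 with hμ₂
  set s : ℝ := αp + αm with hs
  have hs0 : 0 < s := by positivity
  have hμs : 4 * μ₂ - 2 * π * μ₁ ^ 2 = s ^ 2 := by
    have : 2 * π * μ₁ ^ 2 = (p ^ 2 * π) * ((αp - αm) ^ 2 / 2) := by rw [hμ₁]; ring
    rw [this, hp2, hμ₂, hs]; ring
  set g₁ : ℝ → ℝ := fun y => (αp - αm) / 2 * (|y| - p) with hg₁
  set g₂ : ℝ → ℝ := fun y => (αp ^ 2 + αm ^ 2) / 2 * (y ^ 2 - 1)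
    + (αp ^ 2 - αm ^ 2) / 2 * (y * |y| - 2 * p * y) with hg₂
  have hH₁ : HasHermiteRankTwo g₁ := hasHermiteRankTwo_abs.const_mul _
  have hH₂ : HasHermiteRankTwo g₂ :=
    (hasHermiteRankTwo_sq.const_mul _).add (hasHermiteRankTwo_mul_abs.const_mul _)
  set φ : ℝ → ℝ := fun y => αp * y * (if 0 < y then (1 : ℝ) else 0)
    + αm * y * (if y < 0 then (1 : ℝ) else 0) with hφ
  have hφm : Measurable φ := by
    refine ((measurable_const.mul measurable_id).mul ?_).add
      ((measurable_const.mul measurable_id).mul ?_)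
    · exact Measurable.ite measurableSet_Ioi measurable_const measurable_const
    · exact Measurable.ite measurableSet_Iio measurable_const measurable_const
  have hXφ : ∀ t ω, X t ω = φ (Y t ω) := hX
  have hφ₁ : ∀ y, φ y = μ₁ + a * y + g₁ y := by
    intro y
    simp only [hφ, hg₁, hμ₁, ha]
    rcases lt_trichotomy y 0 with h | h | h
    · rw [if_neg h.not_gt, if_pos h, abs_of_neg h]; ring
    · subst h; simp
    · rw [if_pos h, if_neg h.not_gt, abs_of_pos h]; ring
  have hφ₂ : ∀ y, φ y ^ 2 = μ₂ + b * y + g₂ y := by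
    intro y
    simp only [hφ, hg₂, hμ₂, hb]
    rcases lt_trichotomy y 0 with h | h | h
    · rw [if_neg h.not_gt, if_pos h, abs_of_neg h]; ring
    · subst h; simp
    · rw [if_pos h, if_neg h.not_gt, abs_of_pos h]; ring
  have hXm : Measurable (Function.uncurry X) := by
    have : Function.uncurry X = φ ∘ Function.uncurry Y := by
      ext q; exact hXφ _ _
    rw [this]
    exact hφm.comp hYmeas
  have hm1m : ∀ T, Measurable (m1 T) := by
    intro T
    rw [funext (hm1 T)]
    exact (hXm.stronglyMeasurable.integral_prod_left).measurable.const_mul _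
  have hm2m : ∀ T, Measurable (m2 T) := by
    intro T
    rw [funext (hm2 T)]
    have : Measurable (Function.uncurry fun u ω => X u ω ^ 2) := hXm.pow_const 2
    exact (this.stronglyMeasurable.integral_prod_left).measurable.const_mul _
  have hroot : ∀ T, Measurable fun ω => √|4 * m2 T ω - 2 * π * (m1 T ω) ^ 2| := fun T =>
    ((((hm2m T).const_mul 4).sub (((hm1m T).pow_const 2).const_mul (2 * π))).abs).sqrt
  have hPm : ∀ T, Measurable (aPlus T) := by
    intro T
    rw [funext (haPlus T)]
    exact ((hm1m T).const_mul _).add ((hroot T).const_mul _)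
  have hMm : ∀ T, Measurable (aMinus T) := by
    intro T
    rw [funext (haMinus T)]
    exact ((hm1m T).const_mul _).add ((hroot T).const_mul _)
  -- the Gaussian part, and the two remainders of higher Hermite rank
  set I : ℝ → Ω → ℝ := fun T ω => ∫ x in Set.Ioc (0 : ℝ) 1, Y (T * x) ω with hI
  set J₁ : ℝ → Ω → ℝ := fun T ω => ∫ x in Set.Ioc (0 : ℝ) 1, g₁ (Y (T * x) ω) with hJ₁
  set J₂ : ℝ → Ω → ℝ := fun T ω => ∫ x in Set.Ioc (0 : ℝ) 1, g₂ (Y (T * x) ω) with hJ₂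
  have hIm : ∀ T, Measurable (I T) := fun T =>
    ((hY.measurable_comp_scaled T).stronglyMeasurable.integral_prod_left).measurable
  obtain ⟨v, hv⟩ := hY.tendsto_variance hβ0 hβ1 hrlim
  have hJ₁lim := hY.tendsto_integral_sq_comp hH₁ hβ0 hβ1 hrlim
  have hJ₂lim := hY.tendsto_integral_sq_comp hH₂ hβ0 hβ1 hrlim
  set V : ℝ → ℝ := fun T => T ^ (-β) * ∫ ω, I T ω ^ 2 ∂P with hV
  set Z : ℝ → Ω → ℝ := fun T ω => T ^ (1 - H) * I T ω with hZ
  have hZm : ∀ T, Measurable (Z T) := fun T => (hIm T).const_mul _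
  have hNsq : ∀ T : ℝ, 0 < T → (T ^ (1 - H)) ^ 2 = T ^ (-β) := by
    intro T hT
    rw [← Real.rpow_natCast, ← Real.rpow_mul hT.le]
    congr 1
    rw [hβ]; push_cast; ring
  have hδ : ∀ T : ℝ, 0 < T → (T ^ (1 - H))⁻¹ = T ^ (H - 1) := by
    intro T hT
    rw [← Real.rpow_neg hT.le, neg_sub]
  have hV0 : ∀ᶠ T in atTop, 0 ≤ V T := by
    filter_upwards [eventually_gt_atTop 0] with T hT
    exact mul_nonneg (Real.rpow_nonneg hT.le _) (integral_nonneg fun ω => sq_nonneg _)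
  have hv0 : 0 ≤ v := ge_of_tendsto hv hV0
  have hZV : ∀ᶠ T in atTop, P.map (Z T) = gaussianReal 0 (V T).toNNReal := by
    filter_upwards [eventually_gt_atTop 0] with T hT
    have h1 := (hY.map_integral_scaled hT.le).2
    have h2 : P.map (Z T) = (P.map (I T)).map (fun x => T ^ (1 - H) * x) :=
      (Measure.map_map (by fun_prop) (hIm T)).symm
    rw [h2, h1, gaussianReal_map_const_mul, mul_zero]
    congr 1
    apply NNReal.coe_injective
    have h3 : 0 ≤ ∫ ω, I T ω ^ 2 ∂P := integral_nonneg fun ω => sq_nonneg _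
    rw [NNReal.coe_mul, NNReal.coe_mk, Real.coe_toNNReal _ h3, hNsq T hT,
      Real.coe_toNNReal _ (mul_nonneg (Real.rpow_nonneg hT.le _) h3)]
  set Q : ℝ → Ω → ℝ := fun T ω => (T ^ (1 - H) * J₁ T ω) ^ 2 + (T ^ (1 - H) * J₂ T ω) ^ 2
    + (T ^ (1 - H))⁻¹ * Z T ω ^ 2 with hQ
  have hQ0 : ∀ T ω, 0 ≤ T → 0 ≤ Q T ω := fun T ω hT => by
    have := Real.rpow_nonneg hT (1 - H)
    positivity
  have hQI : ∀ T, 0 < T → Integrable (Q T) P ∧ ∫ ω, Q T ω ∂P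
      = T ^ (-β) * (∫ ω, J₁ T ω ^ 2 ∂P) + T ^ (-β) * (∫ ω, J₂ T ω ^ 2 ∂P)
        + T ^ (H - 1) * V T := by
    intro T hT
    have i1 := (hY.integrable_sq_integral_comp hH₁ hT.le).const_mul (T ^ (-β))
    have i2 := (hY.integrable_sq_integral_comp hH₂ hT.le).const_mul (T ^ (-β))
    have i3 := (((hY.map_integral_scaled hT.le).1.integrable_sq).const_mul
      (T ^ (-β))).const_mul (T ^ (H - 1))
    have e : Q T = fun ω => T ^ (-β) * J₁ T ω ^ 2 + T ^ (-β) * J₂ T ω ^ 2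
        + T ^ (H - 1) * (T ^ (-β) * I T ω ^ 2) := by
      ext ω
      simp only [hQ, hZ]
      rw [hδ T hT, mul_pow, mul_pow, mul_pow, hNsq T hT]
    have i12 : Integrable (fun ω => T ^ (-β) * J₁ T ω ^ 2 + T ^ (-β) * J₂ T ω ^ 2) P := i1.add i2
    rw [e]
    refine ⟨i12.add i3, ?_⟩
    rw [integral_add i12 i3, integral_add i1 i2, integral_const_mul, integral_const_mul,
      integral_const_mul, integral_const_mul]
  have hδlim : Tendsto (fun T : ℝ => T ^ (H - 1)) atTop (nhds 0) := by
    simpa using tendsto_rpow_neg_atTop (y := 1 - H) (by linarith [hH.2])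
  have hQlim : Tendsto (fun T => ∫ ω, Q T ω ∂P) atTop (nhds 0) := by
    have h1 := (hJ₁lim.add hJ₂lim).add (hδlim.mul hv)
    rw [zero_mul, add_zero, add_zero] at h1
    refine h1.congr' ?_
    filter_upwards [eventually_gt_atTop 0] with T hT using (hQI T hT).2.symm
  obtain ⟨K₁, hK₁0, hK₁⟩ := exists_delta_method_bound a b μ₁ μ₂ (√(π / 2)) hs0 hμs
  obtain ⟨K₂, hK₂0, hK₂⟩ := exists_delta_method_bound a b μ₁ μ₂ (-√(π / 2)) hs0 hμs
  set w₁ := √(π / 2) * a + (b - π * μ₁ * a) / s with hw₁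
  set w₂ := -√(π / 2) * a + (b - π * μ₁ * a) / s with hw₂
  have hcenter₁ : √(π / 2) * μ₁ + s / 2 = αp := by
    have : √(π / 2) * μ₁ = √(π / 2) * p * ((αp - αm) / 2) := by rw [hμ₁]; ring
    rw [this, hσp, hs]; ring
  have hcenter₂ : -√(π / 2) * μ₁ + s / 2 = αm := by
    have : -√(π / 2) * μ₁ = -(√(π / 2) * p) * ((αp - αm) / 2) := by rw [hμ₁]; ring
    rw [this, hσp, hs]; ring
  set F : ℝ → Ω → ℝ × ℝ := fun T ω => (T ^ (1 - H) * (aPlus T ω - αp),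
    T ^ (1 - H) * (aMinus T ω - αm)) with hF
  have hFm : ∀ T, Measurable (F T) := fun T =>
    (((hPm T).sub_const _).const_mul _).prodMk (((hMm T).sub_const _).const_mul _)
  have hFZ : TendstoInMeasure P (F - fun T ω => (w₁ * Z T ω, w₂ * Z T ω)) atTop 0 := by
    refine tendstoInMeasure_sub_of_integral_tendsto (Q := Q)
      (φ := fun x => (K₁ + K₂) * (√x + x + x ^ 2)) (by fun_prop) (by simp) hQ0 ?_ hQlim ?_
    · filter_upwards [eventually_gt_atTop 0] with T hT using (hQI T hT).1
    · filter_upwards [eventually_ge_atTop 1] with T hT1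
      have hT : 0 < T := by linarith
      have hN : 0 < T ^ (1 - H) := Real.rpow_pos_of_pos hT _
      have hN1 : 1 ≤ T ^ (1 - H) := Real.one_le_rpow hT1 (by linarith [hH.2])
      filter_upwards [hY.ae_integral_comp_eq hH₁ hφ₁ hT.le,
        hY.ae_integral_comp_eq hH₂ hφ₂ hT.le] with ω h1 h2
      have hM1 : m1 T ω = μ₁ + (T ^ (1 - H))⁻¹ * (a * Z T ω + T ^ (1 - H) * J₁ T ω) := by
        rw [hm1, one_div_mul_setIntegral_Ioc hT]
        simp_rw [hXφ]
        rw [h1]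
        simp only [hZ, hI, hJ₁]
        field_simp
        ring
      have hM2 : m2 T ω = μ₂ + (T ^ (1 - H))⁻¹ * (b * Z T ω + T ^ (1 - H) * J₂ T ω) := by
        rw [hm2, one_div_mul_setIntegral_Ioc hT]
        simp_rw [hXφ]
        rw [h2]
        simp only [hZ, hI, hJ₂]
        field_simp
        ring
      have b1 := hK₁ (T ^ (1 - H))⁻¹ (Z T ω) (T ^ (1 - H) * J₁ T ω) (T ^ (1 - H) * J₂ T ω)
        (inv_pos.2 hN) (inv_le_one_of_one_le₀ hN1)
      have b2 := hK₂ (T ^ (1 - H))⁻¹ (Z T ω) (T ^ (1 - H) * J₁ T ω) (T ^ (1 - H) * J₂ T ω)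
        (inv_pos.2 hN) (inv_le_one_of_one_le₀ hN1)
      rw [← hM1, ← hM2, inv_inv, hcenter₁, ← haPlus] at b1
      rw [← hM1, ← hM2, inv_inv, hcenter₂, ← haMinus] at b2
      have hq := hQ0 T ω hT.le
      have hq' : 0 ≤ √(Q T ω) + Q T ω + Q T ω ^ 2 := by positivity
      rw [Prod.norm_def]
      refine max_le ?_ ?_
      · exact b1.trans (mul_le_mul_of_nonneg_right (by linarith) hq')
      · exact b2.trans (mul_le_mul_of_nonneg_right (by linarith) hq')
  refine ⟨!![v * w₁ ^ 2, v * (w₁ * w₂); v * (w₁ * w₂), v * w₂ ^ 2],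
    posSemidef_rankOne hv0 w₁ w₂,
    (gaussianReal 0 v.toNNReal).map fun x => (w₁ * x, w₂ * x),
    Measure.isProbabilityMeasure_map (by fun_prop), fun c d => ?_, fun f => ?_⟩
  · simpa using map_linear_gaussianReal_prod hv0 w₁ w₂ c d
  · exact tendsto_integral_of_gaussian_approx hZm hV0 hZV hv hFm hFZ f
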